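/- Let K be a convex body in ℝ^n. If the Euclidean unit ball B^n ⊇ K is the Löwner ellipsoid of K, then ℓ(K) ≤ ℓ(Δ_n), and if B^n ⊆ K is the John ellipsoid of K, then W(K) ≤ W(Δ_n°). In either case equality holds if and only if K is a regular simplex (inscribed in B^n, respectively circumscribed about B^n). -/

import Mathlib

open MeasureTheory Metric Set
open scoped RealInnerProductSpace ENNReal

noncomputable section

/-- The standard Gaussian measure `γ_n` on `ℝ^n`. -/
def gaussianM (n : ℕ) : Measure (EuclideanSpace ℝ (Fin n)) :=
  volume.withDensity fun x =>
    ENNReal.ofReal ((2 * Real.pi) ^ (-(n : ℝ) / 2) * Real.exp (-‖x‖ ^ 2 / 2))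

/-- The ℓ-norm of a convex body: `ℓ(K) = ∫ ‖x‖_K dγ_n(x)`, where `‖·‖_K` is the gauge of `K`. -/
def ellNorm (n : ℕ) (K : Set (EuclideanSpace ℝ (Fin n))) : ℝ :=
  ∫ x, gauge K x ∂(gaussianM n)

/-- The support function `h_K`. -/
def suppFn {n : ℕ} (K : Set (EuclideanSpace ℝ (Fin n))) (u : EuclideanSpace ℝ (Fin n)) : ℝ :=
  sSup ((fun y => ⟪u, y⟫) '' K)

/-- The mean width `W(K) = (1/(n κ_n)) ∫_{S^{n-1}} (h_K(u) + h_K(-u)) du`, the integration over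
the unit sphere being with respect to the (n-1)-dimensional Hausdorff measure. -/
def meanWidth (n : ℕ) (K : Set (EuclideanSpace ℝ (Fin n))) : ℝ :=
  (1 / (n * (volume (closedBall (0 : EuclideanSpace ℝ (Fin n)) 1)).toReal)) *
    ∫ u in sphere (0 : EuclideanSpace ℝ (Fin n)) 1,
      (suppFn K u + suppFn K (-u)) ∂(μH[(n : ℝ) - 1])

/-- The polar set `K° = {x : ⟨x,y⟩ ≤ 1 for all y ∈ K}`. -/
def polarSet {n : ℕ} (K : Set (EuclideanSpace ℝ (Fin n))) : Set (EuclideanSpace ℝ (Fin n)) :=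
  {x | ∀ y ∈ K, ⟪x, y⟫ ≤ 1}

/-- `w` lists the vertices of a regular simplex inscribed in the unit ball: `n+1` unit vectors
with pairwise inner products `-1/n`. -/
def IsRegVerts {n : ℕ} (w : Fin (n + 1) → EuclideanSpace ℝ (Fin n)) : Prop :=
  (∀ i, ‖w i‖ = 1) ∧ ∀ i j, i ≠ j → ⟪w i, w j⟫ = -1 / n

/-- An ellipsoid: an image of the closed Euclidean unit ball under an invertible affine map. -/
def IsEllipsoid {n : ℕ} (D : Set (EuclideanSpace ℝ (Fin n))) : Prop :=
  ∃ f : EuclideanSpace ℝ (Fin n) ≃ᵃ[ℝ] EuclideanSpace ℝ (Fin n),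
    D = f '' closedBall 0 1

/-- `D` is the Löwner ellipsoid (minimal volume ellipsoid containing) of `K`. -/
def IsLoewnerEllipsoid {n : ℕ} (D K : Set (EuclideanSpace ℝ (Fin n))) : Prop :=
  IsEllipsoid D ∧ K ⊆ D ∧ ∀ D', IsEllipsoid D' → K ⊆ D' → volume D ≤ volume D'

/-- `D` is the John ellipsoid (maximal volume ellipsoid contained in) of `K`. -/
def IsJohnEllipsoid {n : ℕ} (D K : Set (EuclideanSpace ℝ (Fin n))) : Prop :=
  IsEllipsoid D ∧ D ⊆ K ∧ ∀ D', IsEllipsoid D' → D' ⊆ K → volume D' ≤ volume D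

section piece1

theorem det_ineq {F ι : Type*} [NormedAddCommGroup F] [InnerProductSpace ℝ F]
    [FiniteDimensional ℝ F] [Fintype ι] (v : ι → F) (d : ι → ℝ) (hd : ∀ i, 0 ≤ d i)
    (hv : ∀ i, ‖v i‖ = 1) (hdec : ∀ x : F, ∑ i, (d i * ⟪v i, x⟫) • v i = x)
    (t : ι → ℝ) (ht : ∀ i, 0 < t i) (A : F →ₗ[ℝ] F)
    (hA : ∀ x, A x = ∑ i, (d i * t i * ⟪v i, x⟫) • v i) :
    Real.exp (∑ i, d i * Real.log (t i)) ≤ LinearMap.det A := by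
  have hsym : A.IsSymmetric := by
    intro x y
    rw [hA, hA, sum_inner, inner_sum]
    refine Finset.sum_congr rfl fun i _ => ?_
    rw [real_inner_smul_left, real_inner_smul_right, real_inner_comm x (v i)]
    ring
  have hn : Module.finrank ℝ F = Module.finrank ℝ F := rfl
  set b := hsym.eigenvectorBasis hn with hb
  set l := hsym.eigenvalues hn with hl
  have hdet : LinearMap.det A = ∏ k, l k := by
    have := hsym.det_eq_prod_eigenvalues hn
    simpa using this
  have hw : ∀ k, ∑ i, d i * ⟪v i, b k⟫ ^ 2 = 1 := by
    intro k
    have h1 : ⟪∑ i, (d i * ⟪v i, b k⟫) • v i, b k⟫ = 1 := by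
      rw [hdec]; rw [real_inner_self_eq_norm_sq]; simp
    rw [sum_inner] at h1
    rw [← h1]
    refine Finset.sum_congr rfl fun i _ => ?_
    rw [real_inner_smul_left]; ring
  have hlk : ∀ k, l k = ∑ i, (d i * ⟪v i, b k⟫ ^ 2) * t i := by
    intro k
    have h1 : ⟪A (b k), b k⟫ = l k := by
      rw [hsym.apply_eigenvectorBasis hn k, real_inner_smul_left, real_inner_self_eq_norm_sq]
      simp [hl]
    rw [← h1, hA, sum_inner]
    refine Finset.sum_congr rfl fun i _ => ?_
    rw [real_inner_smul_left]; ring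
  have hlog : ∀ k, ∑ i, (d i * ⟪v i, b k⟫ ^ 2) * Real.log (t i) ≤ Real.log (l k) ∧ 0 < l k := by
    intro k
    have h2 := strictConcaveOn_log_Ioi.concaveOn.le_map_sum (t := Finset.univ)
      (w := fun i => d i * ⟪v i, b k⟫ ^ 2) (p := t)
      (fun i _ => mul_nonneg (hd i) (sq_nonneg _)) (hw k) (fun i _ => ht i)
    have h3 := (convex_Ioi (0:ℝ)).sum_mem (t := Finset.univ)
      (w := fun i => d i * ⟪v i, b k⟫ ^ 2) (z := t)
      (fun i _ => mul_nonneg (hd i) (sq_nonneg _)) (hw k) (fun i _ => ht i)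
    simp only [smul_eq_mul] at h2 h3
    rw [hlk k]
    exact ⟨h2, h3⟩
  have hsum : ∑ i, d i * Real.log (t i) =
      ∑ k, ∑ i, (d i * ⟪v i, b k⟫ ^ 2) * Real.log (t i) := by
    rw [Finset.sum_comm]
    refine Finset.sum_congr rfl fun i _ => ?_
    rw [← Finset.sum_mul, ← Finset.mul_sum]
    have : ∑ k, ⟪v i, b k⟫ ^ 2 = 1 := by
      have := b.sum_sq_norm_inner_left (v i)
      rw [hv] at this
      simpa using this
    rw [this, mul_one]
  rw [hdet, hsum]
  calc _ ≤ Real.exp (∑ k, Real.log (l k)) :=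
        Real.exp_le_exp.2 (Finset.sum_le_sum fun k _ => (hlog k).1)
    _ = _ := by
        rw [Real.exp_sum]
        exact Finset.prod_congr rfl fun k _ => Real.exp_log (hlog k).2

end piece1

section piece2

theorem integrable_tilt (s : ℝ) : Integrable (fun x : ℝ => Real.exp (-x ^ 2 / 2 + s * x)) := by
  have h := (integrable_exp_neg_mul_sq (b := 1/2) (by norm_num)).comp_sub_right s
  have h2 := h.const_mul (Real.exp (s ^ 2 / 2))
  refine h2.congr (Filter.Eventually.of_forall fun x => ?_)
  simp only
  rw [← Real.exp_add]
  congr 1; ring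

/-- The mass of the tilted half Gaussian. -/
def Zmass (s : ℝ) : ℝ := ∫ x in Ioi (0:ℝ), Real.exp (-x ^ 2 / 2 + s * x)

theorem Zmass_pos (s : ℝ) : 0 < Zmass s := by
  unfold Zmass
  rw [integral_pos_iff_support_of_nonneg (fun x => (Real.exp_pos _).le)
    (integrable_tilt s).integrableOn]
  have : Function.support (fun x : ℝ => Real.exp (-x ^ 2 / 2 + s * x)) = univ := by
    ext x; simp [(Real.exp_pos _).ne']
  rw [this]; simp

theorem gauss_one : ∫ x : ℝ, Real.exp (-x ^ 2 / 2) = √(2 * Real.pi) := by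
  have := integral_gaussian (1/2)
  rw [show Real.pi / (1/2) = 2 * Real.pi by ring] at this
  rw [← this]
  congr 1; ext x; congr 1; ring

theorem exists_transport (s : ℝ) : ∃ T T' : ℝ → ℝ, (∀ t, HasDerivAt T (T' t) t) ∧
    (∀ t, 0 < T' t) ∧ (∀ t, 0 < T t) ∧ StrictMono T ∧ Filter.Tendsto T Filter.atTop Filter.atTop ∧
    ∀ t, Real.exp (-(T t) ^ 2 / 2 + s * T t) * T' t
      = Zmass s * (Real.exp (-t ^ 2 / 2) / √(2 * Real.pi)) := by
  have hZ := Zmass_pos s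
  have hpi : 0 < √(2 * Real.pi) := by positivity
  set f : ℝ → ℝ := fun x => Real.exp (-x ^ 2 / 2 + s * x) with hf
  set g : ℝ → ℝ := fun t => Zmass s * (Real.exp (-t ^ 2 / 2) / √(2 * Real.pi)) with hg
  have hfc : Continuous f := by fun_prop
  have hgc : Continuous g := by fun_prop
  have hfpos : ∀ x, 0 < f x := fun x => Real.exp_pos _
  have hgpos : ∀ x, 0 < g x := fun x => by positivity
  have hgi : Integrable g := by
    have := (integrable_tilt 0)
    simp only [zero_mul, add_zero] at this
    exact (this.div_const _).const_mul _
  have hgint : ∫ x, g x = Zmass s := by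
    simp only [hg]
    rw [integral_const_mul, integral_div, gauss_one, div_self hpi.ne', mul_one]
  set F : ℝ → ℝ := fun θ => ∫ x in (0:ℝ)..θ, f x with hF
  set P : ℝ → ℝ := fun t => (∫ x in Iic (0:ℝ), g x) + ∫ x in (0:ℝ)..t, g x with hP
  have hFd : ∀ θ, HasStrictDerivAt F (f θ) θ := fun θ => by
    exact hfc.integral_hasStrictDerivAt 0 θ
  have hPd : ∀ θ, HasDerivAt P (g θ) θ := fun θ => by
    exact (hgc.integral_hasStrictDerivAt 0 θ).hasDerivAt.const_add _
  have hFm : StrictMono F := strictMono_of_hasDerivAt_pos (fun x => (hFd x).hasDerivAt) hfpos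
  have hPm : StrictMono P := strictMono_of_hasDerivAt_pos hPd hgpos
  have hFlim : Filter.Tendsto F Filter.atTop (nhds (Zmass s)) :=
    intervalIntegral_tendsto_integral_Ioi 0 (integrable_tilt s).integrableOn Filter.tendsto_id
  have hPtop : Filter.Tendsto P Filter.atTop (nhds (Zmass s)) := by
    have h1 := (intervalIntegral_tendsto_integral_Ioi 0 hgi.integrableOn
      (Filter.tendsto_id (α := ℝ) (x := Filter.atTop))).const_add (∫ x in Iic (0:ℝ), g x)
    have h2 : (∫ x in Iic (0:ℝ), g x) + ∫ x in Ioi (0:ℝ), g x = Zmass s := by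
      rw [← hgint, ← setIntegral_union (Iic_disjoint_Ioi le_rfl) measurableSet_Ioi
        hgi.integrableOn hgi.integrableOn, Iic_union_Ioi, setIntegral_univ]
    rw [h2] at h1
    exact h1
  have hPbot : Filter.Tendsto P Filter.atBot (nhds 0) := by
    have h1 := (intervalIntegral_tendsto_integral_Iic 0 hgi.integrableOn
      (Filter.tendsto_id (α := ℝ) (x := Filter.atBot))).const_sub (∫ x in Iic (0:ℝ), g x)
    rw [sub_self] at h1
    refine h1.congr fun t => ?_
    simp only [hP, id]
    rw [intervalIntegral.integral_symm]; ring
  have hP0 : ∀ t, 0 < P t := fun t =>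
    lt_of_le_of_lt (hPm.monotone.le_of_tendsto hPbot (t-1)) (hPm (by linarith))
  have hPZ : ∀ t, P t < Zmass s := fun t =>
    lt_of_lt_of_le (hPm (by linarith : t < t + 1)) (hPm.monotone.ge_of_tendsto hPtop (t+1))
  have hF0 : F 0 = 0 := by simp [hF]
  have hFZ : ∀ t, F t < Zmass s := fun t =>
    lt_of_lt_of_le (hFm (by linarith : t < t + 1)) (hFm.monotone.ge_of_tendsto hFlim (t+1))
  have hFc : Continuous F := continuous_iff_continuousAt.2 fun x => (hFd x).hasDerivAt.continuousAt
  have hex : ∀ t, ∃ θ, F θ = P t := by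
    intro t
    obtain ⟨b, hb, hb0⟩ := ((hFlim.eventually (lt_mem_nhds (hPZ t))).and
      (Filter.eventually_ge_atTop 0)).exists
    obtain ⟨θ, _, h⟩ := intermediate_value_Icc hb0 hFc.continuousOn
      (show P t ∈ Icc (F 0) (F b) from ⟨by rw [hF0]; exact (hP0 t).le, hb.le⟩)
    exact ⟨θ, h⟩
  choose T hT using hex
  have hder : ∀ t, HasDerivAt T (g t / f (T t)) t := by
    intro t
    have h1 := (hFd (T t)).to_localInverse (hfpos _).ne'
    have h1' := h1.hasDerivAt
    rw [hT t] at h1'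
    have h2 := h1'.comp t (hPd t)
    rw [mul_comm, ← div_eq_mul_inv] at h2
    refine h2.congr_of_eventuallyEq ?_
    have h3 := ((hFd (T t)).hasStrictFDerivAt_equiv (hfpos _).ne').eventually_right_inverse
    rw [hT t] at h3
    have h4 := (hPd t).continuousAt.eventually h3
    filter_upwards [h4] with u hu
    apply hFm.injective
    rw [hT u]
    exact hu.symm
  have hTm : StrictMono T := by
    intro a b hab
    rw [← hFm.lt_iff_lt, hT, hT]
    exact hPm hab
  refine ⟨T, fun t => g t / f (T t), hder, fun t => div_pos (hgpos _) (hfpos _), fun t => ?_, hTm,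
    ?_, fun t => ?_⟩
  · rw [← hFm.lt_iff_lt, hT, hF0]; exact hP0 t
  · rw [Filter.tendsto_atTop]
    intro M
    filter_upwards [hPtop.eventually (lt_mem_nhds (hFZ M))] with t ht
    rw [← hT, hFm.lt_iff_lt] at ht
    exact ht.le
  · change f (T t) * _ = g t
    field_simp [(hfpos (T t)).ne']

end piece2

section piece3

section transport
set_option linter.unusedSectionVars false
variable {F ι : Type*} [NormedAddCommGroup F] [InnerProductSpace ℝ F]
    [FiniteDimensional ℝ F] [Fintype ι]

theorem dec_norm (v : ι → F) (d : ι → ℝ)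
    (hdec : ∀ x : F, ∑ i, (d i * ⟪v i, x⟫) • v i = x) (x : F) :
    ∑ i, d i * ⟪v i, x⟫ ^ 2 = ‖x‖ ^ 2 := by
  rw [← real_inner_self_eq_norm_sq]
  nth_rw 2 [← hdec x]
  rw [sum_inner]
  refine Finset.sum_congr rfl fun i _ => ?_
  rw [real_inner_smul_left]; ring

theorem dec_sum (v : ι → F) (d : ι → ℝ) (hv : ∀ i, ‖v i‖ = 1)
    (hdec : ∀ x : F, ∑ i, (d i * ⟪v i, x⟫) • v i = x) :
    ∑ i, d i = Module.finrank ℝ F := by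
  set b := stdOrthonormalBasis ℝ F
  have h : ∀ i, d i = ∑ k, d i * ⟪v i, b k⟫ ^ 2 := by
    intro i
    rw [← Finset.mul_sum]
    have := b.sum_sq_norm_inner_left (v i)
    rw [hv] at this
    have h2 : ∑ k, ⟪v i, b k⟫ ^ 2 = 1 := by simpa using this
    rw [h2, mul_one]
  calc ∑ i, d i = ∑ i, ∑ k, d i * ⟪v i, b k⟫ ^ 2 := Finset.sum_congr rfl fun i _ => h i
    _ = ∑ k, ∑ i, d i * ⟪v i, b k⟫ ^ 2 := Finset.sum_comm
    _ = ∑ k : Fin (Module.finrank ℝ F), 1 := by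
        refine Finset.sum_congr rfl fun k _ => ?_
        rw [dec_norm v d hdec]; simp
    _ = _ := by simp

theorem dec_defect (v : ι → F) (d : ι → ℝ)
    (hdec : ∀ x : F, ∑ i, (d i * ⟪v i, x⟫) • v i = x) (θ : ι → ℝ) :
    ∑ i, d i * (θ i - ⟪v i, ∑ j, (d j * θ j) • v j⟫) ^ 2
      = ∑ i, d i * θ i ^ 2 - ‖∑ j, (d j * θ j) • v j‖ ^ 2 := by
  set z := ∑ j, (d j * θ j) • v j with hz
  have h1 : ∑ i, d i * θ i * ⟪v i, z⟫ = ‖z‖ ^ 2 := by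
    rw [← real_inner_self_eq_norm_sq]
    nth_rw 2 [hz]
    rw [sum_inner]
    refine Finset.sum_congr rfl fun i _ => ?_
    rw [real_inner_smul_left]
  have h2 := dec_norm v d hdec z
  have : ∀ i, d i * (θ i - ⟪v i, z⟫) ^ 2
      = d i * θ i ^ 2 - 2 * (d i * θ i * ⟪v i, z⟫) + d i * ⟪v i, z⟫ ^ 2 := fun i => by ring
  rw [Finset.sum_congr rfl fun i _ => this i, Finset.sum_add_distrib, Finset.sum_sub_distrib,
    ← Finset.mul_sum, h1, h2]
  ring

/-- The transport map. -/
def Theta (v : ι → F) (d : ι → ℝ) (T : ℝ → ℝ) (y : F) : F := ∑ j, (d j * T ⟪v j, y⟫) • v j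

theorem gauss_F [MeasurableSpace F] [BorelSpace F] (s : ℝ) :
    ∫⁻ y : F, ENNReal.ofReal ((Zmass s / √(2 * Real.pi)) ^ Module.finrank ℝ F
      * Real.exp (-‖y‖ ^ 2 / 2)) = ENNReal.ofReal (Zmass s ^ Module.finrank ℝ F) := by
  have hZ := Zmass_pos s
  have h := GaussianFourier.integral_rexp_neg_mul_sq_norm (V := F) (b := 1 / 2) (by norm_num)
  have hi : Integrable (fun v : F => Real.exp (-(1/2) * ‖v‖ ^ 2)) := by
    by_contra hc
    rw [integral_undef hc] at h
    have : 0 < (Real.pi / (1 / 2)) ^ ((Module.finrank ℝ F : ℝ) / 2) := by positivity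
    linarith
  have he : ∀ v : F, -‖v‖ ^ 2 / 2 = -(1/2) * ‖v‖ ^ 2 := fun v => by ring
  simp_rw [he]
  rw [← ofReal_integral_eq_lintegral_ofReal (hi.const_mul _)
    (Filter.Eventually.of_forall fun x => by positivity), integral_const_mul, h]
  congr 1
  rw [show Real.pi / (1/2) = 2 * Real.pi by ring, div_pow,
    show ((Module.finrank ℝ F : ℝ) / 2) = (1/2) * (Module.finrank ℝ F : ℝ) by ring,
    Real.rpow_mul (by positivity), ← Real.sqrt_eq_rpow, Real.rpow_natCast]
  field_simp

theorem Theta_inj (v : ι → F) (d : ι → ℝ) (hd : ∀ i, 0 < d i)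
    (hv : ∀ i, ‖v i‖ = 1) (hdec : ∀ x : F, ∑ i, (d i * ⟪v i, x⟫) • v i = x)
    (e : F) (he : ∀ i, ⟪v i, e⟫ = 1) (s : ℝ) (T T' : ℝ → ℝ) (hT : ∀ t, HasDerivAt T (T' t) t)
    (hT' : ∀ t, 0 < T' t) (hTm : StrictMono T)
    (hTeq : ∀ t, Real.exp (-(T t) ^ 2 / 2 + s * T t) * T' t
      = Zmass s * (Real.exp (-t ^ 2 / 2) / √(2 * Real.pi))) : Function.Injective (Theta v d T) := by
  intro y y' h
  have h1 : ∑ i, d i * ((T ⟪v i, y⟫ - T ⟪v i, y'⟫) * (⟪v i, y⟫ - ⟪v i, y'⟫)) = 0 := by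
    have h2 : ⟪Theta v d T y - Theta v d T y', y - y'⟫ = 0 := by rw [h]; simp
    rw [← h2]
    unfold Theta
    rw [← Finset.sum_sub_distrib, sum_inner]
    refine Finset.sum_congr rfl fun i _ => ?_
    rw [← sub_smul, real_inner_smul_left, inner_sub_right]; ring
  have hnn : ∀ a b : ℝ, 0 ≤ (T a - T b) * (a - b) := by
    intro a b
    rcases le_total a b with hab | hab
    · exact mul_nonneg_of_nonpos_of_nonpos (sub_nonpos.2 (hTm.monotone hab)) (sub_nonpos.2 hab)
    · exact mul_nonneg (sub_nonneg.2 (hTm.monotone hab)) (sub_nonneg.2 hab)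
  have h3 := (Finset.sum_eq_zero_iff_of_nonneg
    (fun i _ => mul_nonneg (hd i).le (hnn _ _))).1 h1
  have h4 : ∀ i, ⟪v i, y⟫ = ⟪v i, y'⟫ := by
    intro i
    have h5 := h3 i (Finset.mem_univ i)
    rcases mul_eq_zero.1 h5 with h6 | h6
    · exact absurd h6 (hd i).ne'
    · rcases mul_eq_zero.1 h6 with h7 | h7
      · exact hTm.injective (sub_eq_zero.1 h7)
      · exact sub_eq_zero.1 h7
  rw [← hdec y, ← hdec y']
  simp_rw [h4]

theorem Theta_deriv (v : ι → F) (d : ι → ℝ) (hd : ∀ i, 0 < d i)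
    (hv : ∀ i, ‖v i‖ = 1) (hdec : ∀ x : F, ∑ i, (d i * ⟪v i, x⟫) • v i = x)
    (e : F) (he : ∀ i, ⟪v i, e⟫ = 1) (s : ℝ) (T T' : ℝ → ℝ) (hT : ∀ t, HasDerivAt T (T' t) t)
    (hT' : ∀ t, 0 < T' t) (hTm : StrictMono T)
    (hTeq : ∀ t, Real.exp (-(T t) ^ 2 / 2 + s * T t) * T' t
      = Zmass s * (Real.exp (-t ^ 2 / 2) / √(2 * Real.pi))) (y : F) : ∃ A : F →L[ℝ] F, HasFDerivAt (Theta v d T) A y ∧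
    ∀ x, A x = ∑ i, (d i * T' ⟪v i, y⟫ * ⟪v i, x⟫) • v i := by
  have h1 : ∀ i, HasFDerivAt (fun y => (d i * T ⟪v i, y⟫) • v i)
      (((d i * T' ⟪v i, y⟫) • innerSL ℝ (v i)).smulRight (v i)) y := by
    intro i
    have h2 : HasFDerivAt (fun y => ⟪v i, y⟫) (innerSL ℝ (v i)) y := (innerSL ℝ (v i)).hasFDerivAt
    have h3 := ((hT ⟪v i, y⟫).comp_hasFDerivAt y h2).const_mul (d i)
    have h4 := h3.smul_const (v i)
    rw [smul_smul] at h4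
    exact h4
  refine ⟨_, HasFDerivAt.fun_sum (u := Finset.univ) fun i _ => h1 i, fun x => ?_⟩
  simp

theorem Theta_point (v : ι → F) (d : ι → ℝ) (hd : ∀ i, 0 < d i)
    (hv : ∀ i, ‖v i‖ = 1) (hdec : ∀ x : F, ∑ i, (d i * ⟪v i, x⟫) • v i = x)
    (e : F) (he : ∀ i, ⟪v i, e⟫ = 1) (s : ℝ) (T T' : ℝ → ℝ) (hT : ∀ t, HasDerivAt T (T' t) t)
    (hT' : ∀ t, 0 < T' t) (hTm : StrictMono T)
    (hTeq : ∀ t, Real.exp (-(T t) ^ 2 / 2 + s * T t) * T' t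
      = Zmass s * (Real.exp (-t ^ 2 / 2) / √(2 * Real.pi))) (y : F) (A : F →L[ℝ] F)
    (hA : ∀ x, A x = ∑ i, (d i * T' ⟪v i, y⟫ * ⟪v i, x⟫) • v i) :
    (Zmass s / √(2 * Real.pi)) ^ Module.finrank ℝ F * Real.exp (-‖y‖ ^ 2 / 2) *
      Real.exp ((∑ i, d i * T ⟪v i, y⟫ ^ 2 - ‖Theta v d T y‖ ^ 2) / 2) ≤
    |A.det| * Real.exp (-‖Theta v d T y‖ ^ 2 / 2 + s * ⟪Theta v d T y, e⟫) := by
  have hZ := Zmass_pos s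
  have hpi : 0 < √(2 * Real.pi) := by positivity
  have h1 := det_ineq v d (fun i => (hd i).le) hv hdec (fun i => T' ⟪v i, y⟫)
    (fun i => hT' _) (A : F →ₗ[ℝ] F) hA
  have h2 : ⟪Theta v d T y, e⟫ = ∑ i, d i * T ⟪v i, y⟫ := by
    unfold Theta
    rw [sum_inner]
    refine Finset.sum_congr rfl fun i _ => ?_
    rw [real_inner_smul_left, he, mul_one]
  have h3 : ∀ t, -(T t) ^ 2 / 2 + s * T t + Real.log (T' t)
      = Real.log (Zmass s / √(2 * Real.pi)) + -t ^ 2 / 2 := by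
    intro t
    have := congrArg Real.log (hTeq t)
    rw [Real.log_mul (Real.exp_pos _).ne' (hT' t).ne', Real.log_exp] at this
    rw [this, show Zmass s * (Real.exp (-t ^ 2 / 2) / √(2 * Real.pi)) =
      (Zmass s / √(2 * Real.pi)) * Real.exp (-t ^ 2 / 2) by ring,
      Real.log_mul (by positivity) (Real.exp_pos _).ne', Real.log_exp]
  have h4 : (Zmass s / √(2 * Real.pi)) ^ Module.finrank ℝ F * Real.exp (-‖y‖ ^ 2 / 2)
      = Real.exp (∑ i, d i * (-(T ⟪v i, y⟫) ^ 2 / 2 + s * T ⟪v i, y⟫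
        + Real.log (T' ⟪v i, y⟫))) := by
    have h5 : (Zmass s / √(2 * Real.pi)) ^ Module.finrank ℝ F
        = Real.exp ((∑ i, d i) * Real.log (Zmass s / √(2 * Real.pi))) := by
      rw [dec_sum v d hv hdec, Real.exp_nat_mul, Real.exp_log (by positivity)]
    rw [h5, ← Real.exp_add, ← dec_norm v d hdec y, Finset.sum_mul]
    congr 1
    rw [neg_div, Finset.sum_div, ← Finset.sum_neg_distrib, ← Finset.sum_add_distrib]
    refine Finset.sum_congr rfl fun i _ => ?_
    rw [h3]; ring
  rw [h4, ← Real.exp_add, h2]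
  have h6 : (∑ i, d i * (-(T ⟪v i, y⟫) ^ 2 / 2 + s * T ⟪v i, y⟫ + Real.log (T' ⟪v i, y⟫)))
      + (∑ i, d i * T ⟪v i, y⟫ ^ 2 - ‖Theta v d T y‖ ^ 2) / 2
      = ∑ i, d i * Real.log (T' ⟪v i, y⟫)
        + (-‖Theta v d T y‖ ^ 2 / 2 + s * ∑ i, d i * T ⟪v i, y⟫) := by
    have : ∀ i, d i * (-(T ⟪v i, y⟫) ^ 2 / 2 + s * T ⟪v i, y⟫ + Real.log (T' ⟪v i, y⟫))
      = d i * Real.log (T' ⟪v i, y⟫) + s * (d i * T ⟪v i, y⟫) - d i * T ⟪v i, y⟫ ^ 2 / 2 :=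
        fun i => by ring
    rw [Finset.sum_congr rfl fun i _ => this i, Finset.sum_sub_distrib, Finset.sum_add_distrib,
      ← Finset.mul_sum, ← Finset.sum_div]
    ring
  rw [h6, Real.exp_add]
  gcongr
  exact h1.trans (le_abs_self _)

theorem transport_ineq (v : ι → F) (d : ι → ℝ) (hd : ∀ i, 0 < d i)
    (hv : ∀ i, ‖v i‖ = 1) (hdec : ∀ x : F, ∑ i, (d i * ⟪v i, x⟫) • v i = x)
    (e : F) (he : ∀ i, ⟪v i, e⟫ = 1) (s : ℝ) (T T' : ℝ → ℝ) (hT : ∀ t, HasDerivAt T (T' t) t)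
    (hT' : ∀ t, 0 < T' t) (hTm : StrictMono T)
    (hTeq : ∀ t, Real.exp (-(T t) ^ 2 / 2 + s * T t) * T' t
      = Zmass s * (Real.exp (-t ^ 2 / 2) / √(2 * Real.pi))) [MeasurableSpace F] [BorelSpace F] :
    ENNReal.ofReal (Zmass s ^ Module.finrank ℝ F) ≤
      ∫⁻ y : F, ENNReal.ofReal ((Zmass s / √(2 * Real.pi)) ^ Module.finrank ℝ F *
        Real.exp (-‖y‖ ^ 2 / 2) *
        Real.exp ((∑ i, d i * T ⟪v i, y⟫ ^ 2 - ‖Theta v d T y‖ ^ 2) / 2)) ∧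
    ∫⁻ y : F, ENNReal.ofReal ((Zmass s / √(2 * Real.pi)) ^ Module.finrank ℝ F *
        Real.exp (-‖y‖ ^ 2 / 2) *
        Real.exp ((∑ i, d i * T ⟪v i, y⟫ ^ 2 - ‖Theta v d T y‖ ^ 2) / 2)) ≤
    ∫⁻ z in range (Theta v d T), ENNReal.ofReal (Real.exp (-‖z‖ ^ 2 / 2 + s * ⟪z, e⟫)) := by
  have hZ := Zmass_pos s
  constructor
  · rw [← gauss_F (F := F)]
    refine lintegral_mono fun y => ENNReal.ofReal_le_ofReal ?_
    refine le_mul_of_one_le_right (by positivity) (Real.one_le_exp ?_)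
    have := dec_defect v d hdec (fun i => T ⟪v i, y⟫)
    unfold Theta
    rw [← this]
    exact div_nonneg (Finset.sum_nonneg fun i _ => mul_nonneg (hd i).le (sq_nonneg _)) (by norm_num)
  · choose A hA hA2 using Theta_deriv v d hd hv hdec e he s T T' hT hT' hTm hTeq
    rw [← image_univ, lintegral_image_eq_lintegral_abs_det_fderiv_mul volume MeasurableSet.univ
      (fun x _ => (hA x).hasFDerivWithinAt)
      (Theta_inj v d hd hv hdec e he s T T' hT hT' hTm hTeq).injOn, setLIntegral_univ]
    refine lintegral_mono fun y => ?_
    rw [← ENNReal.ofReal_mul (abs_nonneg _)]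
    exact ENNReal.ofReal_le_ofReal
      (Theta_point v d hd hv hdec e he s T T' hT hT' hTm hTeq y (A y) (hA2 y))

theorem transport_eq (v : ι → F) (d : ι → ℝ) (hd : ∀ i, 0 < d i)
    (hv : ∀ i, ‖v i‖ = 1) (hdec : ∀ x : F, ∑ i, (d i * ⟪v i, x⟫) • v i = x)
    (e : F) (he : ∀ i, ⟪v i, e⟫ = 1) (s : ℝ) (T T' : ℝ → ℝ) (hT : ∀ t, HasDerivAt T (T' t) t)
    (hT' : ∀ t, 0 < T' t) (hTm : StrictMono T)
    (hTeq : ∀ t, Real.exp (-(T t) ^ 2 / 2 + s * T t) * T' t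
      = Zmass s * (Real.exp (-t ^ 2 / 2) / √(2 * Real.pi))) [MeasurableSpace F] [BorelSpace F]
    (heq : ∫⁻ z in range (Theta v d T), ENNReal.ofReal (Real.exp (-‖z‖ ^ 2 / 2 + s * ⟪z, e⟫))
      ≤ ENNReal.ofReal (Zmass s ^ Module.finrank ℝ F)) (y : F) (i : ι) :
    T ⟪v i, y⟫ = ⟪v i, Theta v d T y⟫ := by
  have hZ := Zmass_pos s
  have hTc : Continuous T := continuous_iff_continuousAt.2 fun x => (hT x).continuousAt
  have hTh : Continuous (Theta v d T) := by unfold Theta; fun_prop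
  have hQ : ∀ y, 0 ≤ ∑ i, d i * T ⟪v i, y⟫ ^ 2 - ‖Theta v d T y‖ ^ 2 := by
    intro y
    have := dec_defect v d hdec (fun i => T ⟪v i, y⟫)
    unfold Theta
    rw [← this]
    exact Finset.sum_nonneg fun i _ => mul_nonneg (hd i).le (sq_nonneg _)
  have hQc : Continuous fun y => ∑ i, d i * T ⟪v i, y⟫ ^ 2 - ‖Theta v d T y‖ ^ 2 := by fun_prop
  obtain ⟨h1, h2⟩ := transport_ineq v d hd hv hdec e he s T T' hT hT' hTm hTeq
  have h3 := h2.trans heq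
  rw [← gauss_F (F := F)] at h3
  have h4 := ae_eq_of_ae_le_of_lintegral_le (μ := (volume : Measure F))
    (f := fun y => ENNReal.ofReal ((Zmass s / √(2 * Real.pi)) ^ Module.finrank ℝ F
      * Real.exp (-‖y‖ ^ 2 / 2))) (Filter.Eventually.of_forall fun y => by
        refine ENNReal.ofReal_le_ofReal (le_mul_of_one_le_right (by positivity)
          (Real.one_le_exp (div_nonneg (hQ y) (by norm_num)))))
    (by rw [gauss_F]; exact ENNReal.ofReal_ne_top)
    (by
      refine Measurable.aemeasurable (ENNReal.measurable_ofReal.comp (Continuous.measurable ?_))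
      fun_prop) h3
  have h5 : (fun y => ∑ i, d i * T ⟪v i, y⟫ ^ 2 - ‖Theta v d T y‖ ^ 2)
      =ᵐ[(volume : Measure F)] fun _ => 0 := by
    filter_upwards [h4] with y hy
    rw [ENNReal.ofReal_eq_ofReal_iff (by positivity) (by positivity)] at hy
    have h6 : Real.exp ((∑ i, d i * T ⟪v i, y⟫ ^ 2 - ‖Theta v d T y‖ ^ 2) / 2) = 1 := by
      have hc : (Zmass s / √(2 * Real.pi)) ^ Module.finrank ℝ F * Real.exp (-‖y‖ ^ 2 / 2) ≠ 0 := by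
        positivity
      exact mul_left_cancel₀ hc (by rw [mul_one]; exact hy.symm)
    rw [Real.exp_eq_one_iff] at h6
    linarith
  have h7 := congrFun ((hQc.ae_eq_iff_eq volume continuous_const).1 h5) y
  have h8 := dec_defect v d hdec (fun i => T ⟪v i, y⟫)
  unfold Theta at h7 ⊢
  rw [h7] at h8
  have h9 := (Finset.sum_eq_zero_iff_of_nonneg
    (fun i _ => mul_nonneg (hd i).le (sq_nonneg _))).1 h8 i (Finset.mem_univ i)
  rcases mul_eq_zero.1 h9 with h | h
  · exact absurd h (hd i).ne'
  · exact sub_eq_zero.1 (pow_eq_zero_iff two_ne_zero |>.1 h)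

end transport

end piece3

section piece4

theorem orth_of_eq {F ι : Type*} [NormedAddCommGroup F] [InnerProductSpace ℝ F]
    [FiniteDimensional ℝ F] [Fintype ι] (v : ι → F) (d : ι → ℝ) (hd : ∀ i, 0 < d i)
    (hv : ∀ i, ‖v i‖ = 1) (hdec : ∀ x : F, ∑ i, (d i * ⟪v i, x⟫) • v i = x)
    (e : F) (he : ∀ i, ⟪v i, e⟫ = 1) (T : ℝ → ℝ)
    (hTpos : ∀ t, 0 < T t) (hTm : StrictMono T)
    (hTtop : Filter.Tendsto T Filter.atTop Filter.atTop)
    (h : ∀ y i, T ⟪v i, y⟫ = ⟪v i, Theta v d T y⟫) (i j : ι) (hij : v i ≠ v j) :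
    ⟪v i, v j⟫ = 0 := by
  classical
  -- a separating level
  have hlt : ∀ k, v k ≠ v j → ⟪v k, v j⟫ < 1 := by
    intro k hk
    exact inner_lt_one_iff_real_of_norm_eq_one (hv k) (hv j) |>.2 hk
  obtain ⟨t, ht1, ht⟩ : ∃ t < (1:ℝ), ∀ k, v k ≠ v j → ⟪v k, v j⟫ < t := by
    have h1 : ∀ᶠ t in nhdsWithin (1:ℝ) (Iio 1), ∀ k, v k ≠ v j → ⟪v k, v j⟫ < t := by
      rw [Filter.eventually_all]
      intro k
      by_cases hk : v k = v j
      · exact Filter.Eventually.of_forall fun t h => absurd hk h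
      · filter_upwards [mem_nhdsWithin_of_mem_nhds (lt_mem_nhds (hlt k hk))] with t ht _
        exact ht
    obtain ⟨t, h2, h3⟩ := (h1.and self_mem_nhdsWithin).exists
    exact ⟨t, h3, h2⟩
  let L : F →ₗ[ℝ] (ι → ℝ) := LinearMap.pi fun k => (innerSL ℝ (v k) : F →ₗ[ℝ] ℝ)
  have hL : ∀ x k, L x k = ⟪v k, x⟫ := fun x k => by simp [L]
  have hclosed : IsClosed (LinearMap.range L : Set (ι → ℝ)) :=
    Submodule.closed_of_finiteDimensional _
  have hlim : Filter.Tendsto (fun R : ℝ => L ((T (R * (1 - t)))⁻¹ • Theta v d T (R • (v j - t • e))))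
      Filter.atTop (nhds fun k => if v k = v j then (1:ℝ) else 0) := by
    rw [tendsto_pi_nhds]
    intro k
    have hval : ∀ R : ℝ, L ((T (R * (1 - t)))⁻¹ • Theta v d T (R • (v j - t • e))) k
        = (T (R * (1 - t)))⁻¹ * T (R * (⟪v k, v j⟫ - t)) := by
      intro R
      rw [hL, real_inner_smul_right, ← h, real_inner_smul_right, inner_sub_right,
        real_inner_smul_right, he, mul_one]
    simp_rw [hval]
    by_cases hk : v k = v j
    · simp only [hk, if_true, real_inner_self_eq_norm_sq, hv, one_pow]
      refine tendsto_const_nhds.congr fun R => ?_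
      rw [inv_mul_cancel₀ (hTpos _).ne']
    · simp only [hk, if_false]
      have h1 : Filter.Tendsto (fun R : ℝ => (T (R * (1 - t)))⁻¹) Filter.atTop (nhds 0) :=
        (hTtop.comp (Filter.tendsto_id.atTop_mul_const (by linarith))).inv_tendsto_atTop
      have h2 := h1.mul_const (T 0)
      rw [zero_mul] at h2
      refine tendsto_of_tendsto_of_tendsto_of_le_of_le' tendsto_const_nhds h2 ?_ ?_
      · exact Filter.Eventually.of_forall fun R =>
          mul_nonneg (inv_nonneg.2 (hTpos _).le) (hTpos _).le
      · filter_upwards [Filter.eventually_ge_atTop 0] with R hR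
        refine mul_le_mul_of_nonneg_left (hTm.monotone ?_) (inv_nonneg.2 (hTpos _).le)
        exact mul_nonpos_of_nonneg_of_nonpos hR (by linarith [ht k hk])
  have hmem := hclosed.mem_of_tendsto hlim (Filter.Eventually.of_forall fun R => ⟨_, rfl⟩)
  obtain ⟨z, hz⟩ := hmem
  have hz' : ∀ k, ⟪v k, z⟫ = if v k = v j then 1 else 0 := fun k => by rw [← hL, hz]
  have hz2 : z = (∑ k, if v k = v j then d k else 0) • v j := by
    rw [← hdec z, Finset.sum_smul]
    refine Finset.sum_congr rfl fun k _ => ?_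
    rw [hz']
    split_ifs with hk
    · rw [hk, mul_one]
    · simp
  have hD : 0 < ∑ k, if v k = v j then d k else 0 := by
    refine lt_of_lt_of_le (hd j) ?_
    refine (by simp : d j ≤ if v j = v j then d j else 0).trans
      (Finset.single_le_sum (f := fun k => if v k = v j then d k else 0) (fun k _ => ?_)
        (Finset.mem_univ j))
    split_ifs
    · exact (hd k).le
    · exact le_rfl
  have h3 := hz' i
  rw [if_neg hij, hz2, real_inner_smul_right] at h3
  exact (mul_eq_zero.1 h3).resolve_left hD.ne'

end piece4

section piece5

theorem onb_orthant {F ι : Type*} [NormedAddCommGroup F] [InnerProductSpace ℝ F]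
    [FiniteDimensional ℝ F] [Fintype ι] [MeasurableSpace F] [BorelSpace F]
    (b : OrthonormalBasis ι ℝ F) (e : F) (he : ∀ i, ⟪b i, e⟫ = 1) (s : ℝ) :
    ∫⁻ z in {z : F | ∀ i, 0 ≤ ⟪b i, z⟫}, ENNReal.ofReal (Real.exp (-‖z‖ ^ 2 / 2 + s * ⟪z, e⟫))
      ≤ ENNReal.ofReal (Zmass s ^ Fintype.card ι) := by
  classical
  set φ : ℝ → ℝ := indicator (Ici 0) fun x => Real.exp (-x ^ 2 / 2 + s * x) with hφ
  have hφ0 : ∀ x, 0 ≤ φ x := fun x => indicator_nonneg (fun _ _ => (Real.exp_pos _).le) x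
  have hφi : Integrable φ := (integrable_tilt s).indicator measurableSet_Ici
  have hφint : ∫ x, φ x = Zmass s := by
    rw [hφ, integral_indicator measurableSet_Ici, integral_Ici_eq_integral_Ioi]; rfl
  have hm : MeasurableSet {z : F | ∀ i, 0 ≤ ⟪b i, z⟫} := by
    rw [ofPred_forall]
    refine MeasurableSet.iInter fun i => ?_
    exact (isClosed_le continuous_const (by fun_prop)).measurableSet
  have hpt : ∀ z : F, indicator {z : F | ∀ i, 0 ≤ ⟪b i, z⟫}
      (fun z => ENNReal.ofReal (Real.exp (-‖z‖ ^ 2 / 2 + s * ⟪z, e⟫))) z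
      ≤ ENNReal.ofReal (∏ i, φ (b.repr z i)) := by
    intro z
    by_cases hz : z ∈ {z : F | ∀ i, 0 ≤ ⟪b i, z⟫}
    · rw [indicator_of_mem hz]
      apply ENNReal.ofReal_le_ofReal
      apply le_of_eq
      have h1 : ∀ i, φ (b.repr z i) = Real.exp (-⟪b i, z⟫ ^ 2 / 2 + s * ⟪b i, z⟫) := by
        intro i
        rw [b.repr_apply_apply, hφ, indicator_of_mem (mem_Ici.2 (hz i))]
      rw [Finset.prod_congr rfl fun i _ => h1 i, ← Real.exp_sum]
      congr 1
      have h2 : ‖z‖ ^ 2 = ∑ i, ⟪b i, z⟫ ^ 2 := by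
        rw [← b.sum_sq_norm_inner_right z]; simp
      have h3 : ⟪z, e⟫ = ∑ i, ⟪b i, z⟫ := by
        rw [← b.sum_inner_mul_inner]
        refine Finset.sum_congr rfl fun i _ => ?_
        rw [he, mul_one, real_inner_comm]
      rw [Finset.sum_add_distrib, ← Finset.mul_sum, h3, h2, ← Finset.sum_div,
        Finset.sum_neg_distrib]
    · rw [indicator_of_notMem hz]; exact zero_le
  rw [← lintegral_indicator hm]
  refine (lintegral_mono hpt).trans ?_
  have hmp : MeasurePreserving (fun z => WithLp.ofLp (b.repr z)) :=
    (PiLp.volume_preserving_ofLp ι).comp b.measurePreserving_repr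
  have hIntg : Integrable (fun x : ι → ℝ => ∏ i, φ (x i)) := Integrable.fintype_prod fun i => hφi
  have h4 : ∫⁻ z : F, ENNReal.ofReal (∏ i, φ (b.repr z i))
      = ∫⁻ x : ι → ℝ, ENNReal.ofReal (∏ i, φ (x i)) := by
    rw [← hmp.map_eq, lintegral_map' _ hmp.measurable.aemeasurable]
    rw [hmp.map_eq]
    exact hIntg.aemeasurable.ennreal_ofReal
  rw [h4, ← ofReal_integral_eq_lintegral_ofReal hIntg
    (Filter.Eventually.of_forall fun x => Finset.prod_nonneg fun i _ => hφ0 _),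
    integral_fintype_prod_volume_eq_pow, hφint]

end piece5

section piece6

/-- A John decomposition of the identity. -/
def ContactDec {n : ℕ} {ι : Type} [Fintype ι] (u : ι → EuclideanSpace ℝ (Fin n)) (c : ι → ℝ) :
    Prop :=
  (∀ i, 0 < c i) ∧ (∀ i, ‖u i‖ = 1) ∧ ∑ i, c i • u i = 0 ∧
    ∀ x, ∑ i, (c i * ⟪u i, x⟫) • u i = x

/-- The lift of a vector to one dimension higher. -/
def liftV {n : ℕ} (u : EuclideanSpace ℝ (Fin n)) : WithLp 2 (EuclideanSpace ℝ (Fin n) × ℝ) :=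
  WithLp.toLp 2 ((√n / √(n + 1)) • u, 1 / √(n + 1))

/-- The axis vector. -/
def axisV (n : ℕ) : WithLp 2 (EuclideanSpace ℝ (Fin n) × ℝ) :=
  WithLp.toLp 2 (0, √(n + 1))

/-- The cone over `L`. -/
def coneOf {n : ℕ} (L : Set (EuclideanSpace ℝ (Fin n))) :
    Set (WithLp 2 (EuclideanSpace ℝ (Fin n) × ℝ)) :=
  {z | 0 < z.snd ∧ gauge L z.fst ≤ √n * z.snd}

@[simp] theorem liftV_fst {n : ℕ} (u : EuclideanSpace ℝ (Fin n)) :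
    (liftV u).fst = (√n / √(n + 1)) • u := rfl

@[simp] theorem liftV_snd {n : ℕ} (u : EuclideanSpace ℝ (Fin n)) :
    (liftV u).snd = 1 / √(n + 1) := rfl

theorem lift_alg1 (p q N c I z : ℝ) (hp : p ^ 2 = N) (hq : q ^ 2 = N + 1) (hp0 : p ≠ 0)
    (hq0 : q ≠ 0) : (N + 1) / N * c * (p / q * I + z / q) = q / p * (c * I) + q / N * z * c := by
  rw [← hq, ← hp]; field_simp

theorem lift_alg2 (p q N c I z : ℝ) (hp : p ^ 2 = N) (hp0 : p ≠ 0)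
    (hq0 : q ≠ 0) : (q / p * (c * I) + q / N * z * c) * (p / q) = c * I + z / p * c := by
  rw [← hp]; field_simp

theorem inner_liftV {n : ℕ} (u : EuclideanSpace ℝ (Fin n))
    (z : WithLp 2 (EuclideanSpace ℝ (Fin n) × ℝ)) :
    ⟪liftV u, z⟫ = (√n / √(n + 1)) * ⟪u, z.fst⟫ + z.snd / √(n + 1) := by
  rw [WithLp.prod_inner_apply]
  simp only [liftV, real_inner_smul_left]
  simp [div_eq_mul_inv]

theorem inner_axisV {n : ℕ} (z : WithLp 2 (EuclideanSpace ℝ (Fin n) × ℝ)) :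
    ⟪z, axisV n⟫ = √(n + 1) * z.snd := by
  rw [WithLp.prod_inner_apply]
  simp [axisV]

theorem inner_liftV_liftV {n : ℕ} (u v : EuclideanSpace ℝ (Fin n)) :
    ⟪liftV u, liftV v⟫ = (n * ⟪u, v⟫ + 1) / (n + 1) := by
  rw [inner_liftV]
  simp only [liftV_fst, liftV_snd, real_inner_smul_right]
  have h1 : √(n:ℝ) ^ 2 = n := Real.sq_sqrt (by positivity)
  have h2 : √((n:ℝ) + 1) ^ 2 = n + 1 := Real.sq_sqrt (by positivity)
  have h3 : √((n:ℝ) + 1) ≠ 0 := by positivity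
  rw [show √(n:ℝ) / √(n + 1) * (√n / √(n + 1) * ⟪u, v⟫) + 1 / √(n + 1) / √(n + 1)
    = (√(n:ℝ) ^ 2 * ⟪u, v⟫ + 1) / √((n:ℝ) + 1) ^ 2 by field_simp, h1, h2]

theorem inner_liftV_axisV {n : ℕ} (u : EuclideanSpace ℝ (Fin n)) : ⟪liftV u, axisV n⟫ = 1 := by
  rw [inner_axisV]
  have h3 : √((n:ℝ) + 1) ≠ 0 := by positivity
  rw [liftV_snd]
  field_simp

theorem norm_liftV {n : ℕ} (u : EuclideanSpace ℝ (Fin n)) (hu : ‖u‖ = 1) : ‖liftV u‖ = 1 := by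
  have h : ‖liftV u‖ ^ 2 = 1 := by
    rw [← real_inner_self_eq_norm_sq, inner_liftV_liftV, real_inner_self_eq_norm_sq, hu]
    have : (n:ℝ) + 1 ≠ 0 := by positivity
    field_simp
  nlinarith [norm_nonneg (liftV u)]

theorem finrank_FF (n : ℕ) :
    Module.finrank ℝ (WithLp 2 (EuclideanSpace ℝ (Fin n) × ℝ)) = n + 1 := by
  rw [(WithLp.linearEquiv 2 ℝ (EuclideanSpace ℝ (Fin n) × ℝ)).finrank_eq]
  simp

section dec
variable {n : ℕ} {ι : Type} [Fintype ι] {u : ι → EuclideanSpace ℝ (Fin n)} {c : ι → ℝ}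

theorem ContactDec.sum_c (h : ContactDec u c) : ∑ i, c i = n := by
  rw [dec_sum u c h.2.1 h.2.2.2]; simp

theorem ContactDec.sum_inner (h : ContactDec u c) (x : EuclideanSpace ℝ (Fin n)) :
    ∑ i, c i * ⟪u i, x⟫ = 0 := by
  have : ⟪∑ i, c i • u i, x⟫ = 0 := by rw [h.2.2.1, inner_zero_left]
  rw [_root_.sum_inner] at this
  simpa only [real_inner_smul_left] using this

theorem ContactDec.lift_dec (hn : 1 ≤ n) (h : ContactDec u c)
    (z : WithLp 2 (EuclideanSpace ℝ (Fin n) × ℝ)) :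
    ∑ i, (((n + 1) / n * c i) * ⟪liftV (u i), z⟫) • liftV (u i) = z := by
  have hn0 : (0:ℝ) < n := by exact_mod_cast hn
  have h1 : √(n:ℝ) ^ 2 = n := Real.sq_sqrt (by positivity)
  have h2 : √((n:ℝ) + 1) ^ 2 = n + 1 := Real.sq_sqrt (by positivity)
  have h3 : √((n:ℝ) + 1) ≠ 0 := by positivity
  have h4 : √((n:ℝ)) ≠ 0 := by positivity
  have hk : ∀ i, ((n + 1) / n * c i) * ⟪liftV (u i), z⟫
      = √((n:ℝ) + 1) / √n * (c i * ⟪u i, z.fst⟫) + √((n:ℝ) + 1) / n * z.snd * c i := by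
    intro i
    rw [inner_liftV]
    exact lift_alg1 _ _ _ _ _ _ h1 h2 h4 h3
  refine WithLp.ofLp_injective 2 ?_
  refine Prod.ext ?_ ?_
  · rw [WithLp.ofLp_sum, Prod.fst_sum]
    have : ∀ i, ((((n + 1) / n * c i) * ⟪liftV (u i), z⟫) • liftV (u i)).ofLp.1
        = (c i * ⟪u i, z.fst⟫) • u i + (z.snd / √n) • (c i • u i) := by
      intro i
      rw [hk]
      simp only [liftV, WithLp.ofLp_smul, Prod.smul_fst, smul_smul, ← add_smul]
      congr 1
      exact lift_alg2 _ _ _ _ _ _ h1 h4 h3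
    rw [Finset.sum_congr rfl fun i _ => this i, Finset.sum_add_distrib, h.2.2.2,
      ← Finset.smul_sum, h.2.2.1, smul_zero, add_zero]
    rfl
  · rw [WithLp.ofLp_sum, Prod.snd_sum]
    have : ∀ i, ((((n + 1) / n * c i) * ⟪liftV (u i), z⟫) • liftV (u i)).ofLp.2
        = (1 / √n) * (c i * ⟪u i, z.fst⟫) + (z.snd / n) * c i := by
      intro i
      rw [hk]
      simp only [liftV, WithLp.ofLp_smul, Prod.smul_snd, smul_eq_mul]
      field_simp
    rw [Finset.sum_congr rfl fun i _ => this i, Finset.sum_add_distrib, ← Finset.mul_sum,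
      ← Finset.mul_sum, h.sum_inner, h.sum_c]
    field_simp
    simp

theorem ContactDec.nonempty (hn : 1 ≤ n) (h : ContactDec u c) : Nonempty ι := by
  by_contra hc
  rw [not_nonempty_iff] at hc
  have := h.sum_c
  rw [Finset.univ_eq_empty, Finset.sum_empty] at this
  have hn0 : (0:ℝ) < n := by exact_mod_cast hn
  linarith

theorem ContactDec.nhds (hn : 1 ≤ n) (h : ContactDec u c) :
    convexHull ℝ (range u) ∈ nhds (0 : EuclideanSpace ℝ (Fin n)) := by
  have hn0 : (0:ℝ) < n := by exact_mod_cast hn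
  refine Filter.mem_of_superset (closedBall_mem_nhds 0 (inv_pos.2 hn0)) fun x hx => ?_
  rw [mem_closedBall_zero_iff] at hx
  have h1 : x = ∑ i, (c i * ⟪u i, x⟫ + c i * (n:ℝ)⁻¹) • u i := by
    simp_rw [add_smul, Finset.sum_add_distrib]
    rw [h.2.2.2]
    have : ∑ i, (c i * (n:ℝ)⁻¹) • u i = (n:ℝ)⁻¹ • ∑ i, c i • u i := by
      rw [Finset.smul_sum]
      exact Finset.sum_congr rfl fun i _ => by rw [smul_smul, mul_comm]
    rw [this, h.2.2.1, smul_zero, add_zero]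
  rw [h1]
  refine (convex_convexHull ℝ _).sum_mem (fun i _ => ?_) ?_
    (fun i _ => subset_convexHull ℝ _ (mem_range_self i))
  · rw [← mul_add]
    refine mul_nonneg (h.1 i).le ?_
    have := abs_real_inner_le_norm (u i) x
    rw [h.2.1, one_mul] at this
    linarith [neg_abs_le ⟪u i, x⟫]
  · rw [Finset.sum_add_distrib, h.sum_inner, ← Finset.sum_mul, h.sum_c, zero_add,
      mul_inv_cancel₀ hn0.ne']

theorem ContactDec.range_sub (hn : 1 ≤ n) (h : ContactDec u c) (T : ℝ → ℝ) (hT : ∀ t, 0 < T t) :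
    range (Theta (fun i => liftV (u i)) (fun i => (n + 1) / n * c i) T)
      ⊆ coneOf (convexHull ℝ (range u)) := by
  have hn0 : (0:ℝ) < n := by exact_mod_cast hn
  have := h.nonempty hn
  rintro _ ⟨y, rfl⟩
  set a : ι → ℝ := fun i => (n + 1) / n * c i * T ⟪liftV (u i), y⟫ with ha
  have hapos : ∀ i, 0 < a i := fun i =>
    mul_pos (mul_pos (by positivity) (h.1 i)) (hT _)
  have hS : 0 < ∑ i, a i := Finset.sum_pos (fun i _ => hapos i) Finset.univ_nonempty
  have hsnd : (Theta (fun i => liftV (u i)) (fun i => (n + 1) / n * c i) T y).snd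
      = (∑ i, a i) / √(n + 1) := by
    change (∑ i, a i • liftV (u i)).ofLp.2 = _
    rw [WithLp.ofLp_sum, Prod.snd_sum, Finset.sum_div]
    refine Finset.sum_congr rfl fun i _ => ?_
    simp [liftV, div_eq_mul_inv]
  have hfst : (Theta (fun i => liftV (u i)) (fun i => (n + 1) / n * c i) T y).fst
      = (√n * ((∑ i, a i) / √(n + 1))) • ∑ i, (a i / ∑ i, a i) • u i := by
    change (∑ i, a i • liftV (u i)).ofLp.1 = _
    rw [WithLp.ofLp_sum, Prod.fst_sum, Finset.smul_sum]
    refine Finset.sum_congr rfl fun i _ => ?_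
    simp only [liftV, WithLp.ofLp_smul, Prod.smul_fst, smul_smul]
    congr 1
    field_simp
  refine ⟨?_, ?_⟩
  · rw [hsnd]; positivity
  · rw [hsnd, hfst]
    refine gauge_le_of_mem (by positivity) (smul_mem_smul_set ?_)
    refine (convex_convexHull ℝ _).sum_mem (fun i _ => (div_pos (hapos i) hS).le) ?_
      (fun i _ => subset_convexHull ℝ _ (mem_range_self i))
    rw [← Finset.sum_div, div_self hS.ne']

/-- Gaussian-type mass of the cone. -/
def Amass {n : ℕ} (L : Set (EuclideanSpace ℝ (Fin n))) (s : ℝ) : ℝ≥0∞ :=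
  ∫⁻ z in coneOf L, ENNReal.ofReal (Real.exp (-‖z‖ ^ 2 / 2 + s * ⟪z, axisV n⟫))

theorem ContactDec.A_lower (hn : 1 ≤ n) (h : ContactDec u c) (s : ℝ) :
    ENNReal.ofReal (Zmass s ^ (n + 1)) ≤ Amass (convexHull ℝ (range u)) s := by
  obtain ⟨T, T', h1, h2, h3, h4, h5, h6⟩ := exists_transport s
  have hn0 : (0:ℝ) < n := by exact_mod_cast hn
  obtain ⟨h7, h8⟩ := transport_ineq (fun i => liftV (u i)) (fun i => (n + 1) / n * c i)
    (fun i => mul_pos (by positivity) (h.1 i)) (fun i => norm_liftV _ (h.2.1 i))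
    (h.lift_dec hn) (axisV n) (fun i => inner_liftV_axisV _) s T T' h1 h2 h4 h6
  rw [finrank_FF] at h7 h8
  exact h7.trans (h8.trans (lintegral_mono_set (h.range_sub hn T h3)))

theorem ContactDec.A_eq (hn : 1 ≤ n) (h : ContactDec u c) (s : ℝ)
    (hA : Amass (convexHull ℝ (range u)) s ≤ ENNReal.ofReal (Zmass s ^ (n + 1)))
    (i j : ι) (hij : u i ≠ u j) : ⟪u i, u j⟫ = -1 / n := by
  obtain ⟨T, T', h1, h2, h3, h4, h5, h6⟩ := exists_transport s
  have hn0 : (0:ℝ) < n := by exact_mod_cast hn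
  have h7 := transport_eq (fun i => liftV (u i)) (fun i => (n + 1) / n * c i)
    (fun i => mul_pos (by positivity) (h.1 i)) (fun i => norm_liftV _ (h.2.1 i))
    (h.lift_dec hn) (axisV n) (fun i => inner_liftV_axisV _) s T T' h1 h2 h4 h6
    (by rw [finrank_FF]; exact (lintegral_mono_set (h.range_sub hn T h3)).trans hA)
  have h8 := orth_of_eq (fun i => liftV (u i)) (fun i => (n + 1) / n * c i)
    (fun i => mul_pos (by positivity) (h.1 i)) (fun i => norm_liftV _ (h.2.1 i))
    (h.lift_dec hn) (axisV n) (fun i => inner_liftV_axisV _) T h3 h4 h5 h7 i j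
    (by
      intro hc
      apply hij
      have := congrArg (fun z => z.fst) hc
      simp only [liftV] at this
      exact smul_right_injective _ (by positivity : √(n:ℝ) / √(n + 1) ≠ 0) this)
  rw [inner_liftV_liftV, div_eq_zero_iff] at h8
  rcases h8 with h8 | h8
  · field_simp; linarith
  · exact absurd h8 (by positivity)

end dec

end piece6

section piece7

theorem IsRegVerts.orthonormal {n : ℕ} (hn : 1 ≤ n) {w : Fin (n + 1) → EuclideanSpace ℝ (Fin n)}
    (hw : IsRegVerts w) : Orthonormal ℝ fun i => liftV (w i) := by
  have hn0 : (0:ℝ) < n := by exact_mod_cast hn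
  refine ⟨fun i => norm_liftV _ (hw.1 i), fun i j hij => ?_⟩
  change ⟪liftV (w i), liftV (w j)⟫ = 0
  rw [inner_liftV_liftV, hw.2 i j hij]
  field_simp
  simp

/-- The orthonormal basis coming from a regular simplex. -/
def regBasis {n : ℕ} (hn : 1 ≤ n) {w : Fin (n + 1) → EuclideanSpace ℝ (Fin n)}
    (hw : IsRegVerts w) :
    OrthonormalBasis (Fin (n + 1)) ℝ (WithLp 2 (EuclideanSpace ℝ (Fin n) × ℝ)) :=
  OrthonormalBasis.mk (hw.orthonormal hn) (by
    have h := (hw.orthonormal hn).linearIndependent.span_eq_top_of_card_eq_finrank'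
      (by rw [finrank_FF]; simp)
    exact h.ge)

theorem regBasis_apply {n : ℕ} (hn : 1 ≤ n) {w : Fin (n + 1) → EuclideanSpace ℝ (Fin n)}
    (hw : IsRegVerts w) (i : Fin (n + 1)) : regBasis hn hw i = liftV (w i) := by
  simp [regBasis]

theorem IsRegVerts.dec {n : ℕ} (hn : 1 ≤ n) {w : Fin (n + 1) → EuclideanSpace ℝ (Fin n)}
    (hw : IsRegVerts w) : ContactDec w fun _ => (n:ℝ) / (n + 1) := by
  have hn0 : (0:ℝ) < n := by exact_mod_cast hn
  have h1 : √(n:ℝ) ^ 2 = n := Real.sq_sqrt (by positivity)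
  have h2 : √((n:ℝ) + 1) ^ 2 = n + 1 := Real.sq_sqrt (by positivity)
  have h3 : √((n:ℝ) + 1) ≠ 0 := by positivity
  have h4 : √((n:ℝ)) ≠ 0 := by positivity
  have key : ∀ z : WithLp 2 (EuclideanSpace ℝ (Fin n) × ℝ),
      ∑ i, (⟪liftV (w i), z⟫ * (√(n:ℝ) / √(n + 1))) • w i = z.fst := by
    intro z
    have := (regBasis hn hw).sum_repr' z
    simp only [regBasis_apply] at this
    have h5 := congrArg (fun z => z.ofLp.1) this
    simp only [WithLp.ofLp_sum, Prod.fst_sum, WithLp.ofLp_smul, Prod.smul_fst] at h5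
    rw [← WithLp.ofLp_fst, ← h5]
    refine Finset.sum_congr rfl fun i _ => ?_
    rw [WithLp.ofLp_fst, liftV_fst, smul_smul]
  refine ⟨fun i => by positivity, hw.1, ?_, fun x => ?_⟩
  · have h5 := key (WithLp.toLp 2 (0, √(n + 1) * (√(n:ℝ) / √(n + 1))))
    rw [show (WithLp.toLp 2 ((0 : EuclideanSpace ℝ (Fin n)), √((n:ℝ) + 1) * (√(n:ℝ) / √(n + 1)))).fst
      = 0 from rfl] at h5
    rw [← h5]
    refine Finset.sum_congr rfl fun i _ => ?_
    congr 1
    rw [inner_liftV]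
    simp only [WithLp.toLp_fst, WithLp.toLp_snd, inner_zero_right]
    nth_rw 1 [← h1]
    rw [← h2]
    field_simp
    simp
  · have h5 := key (WithLp.toLp 2 (x, 0))
    rw [show (WithLp.toLp 2 (x, (0:ℝ))).fst = x from rfl] at h5
    nth_rw 2 [← h5]
    refine Finset.sum_congr rfl fun i _ => ?_
    congr 1
    rw [inner_liftV]
    simp only [WithLp.toLp_fst, WithLp.toLp_snd]
    nth_rw 1 [← h1]
    rw [← h2]
    field_simp
    simp
    ring

theorem inner_le_gauge {n : ℕ} {L : Set (EuclideanSpace ℝ (Fin n))} (hL : L ∈ nhds 0)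
    {y : EuclideanSpace ℝ (Fin n)} (hy : y ∈ polarSet L) (x : EuclideanSpace ℝ (Fin n)) :
    ⟪y, x⟫ ≤ gauge L x := by
  have habs : Absorbent ℝ L := absorbent_nhds_zero hL
  refine le_of_forall_gt fun b hb => ?_
  obtain ⟨r, hr0, hrb, hr⟩ := exists_lt_of_gauge_lt habs hb
  obtain ⟨p, hp, rfl⟩ := hr
  have := hy p hp
  simp only [real_inner_smul_right]
  nlinarith

theorem IsRegVerts.A_upper {n : ℕ} (hn : 1 ≤ n) {w : Fin (n + 1) → EuclideanSpace ℝ (Fin n)}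
    (hw : IsRegVerts w) (s : ℝ) :
    Amass (convexHull ℝ (range w)) s ≤ ENNReal.ofReal (Zmass s ^ (n + 1)) := by
  have hn0 : (0:ℝ) < n := by exact_mod_cast hn
  have h1 : √(n:ℝ) ^ 2 = n := Real.sq_sqrt (by positivity)
  have hpos : 0 < √(n:ℝ) := by positivity
  have h := onb_orthant (regBasis hn hw) (axisV n)
    (fun i => by rw [regBasis_apply]; exact inner_liftV_axisV _) s
  rw [Fintype.card_fin] at h
  refine (lintegral_mono_set ?_).trans h
  rintro z ⟨hz1, hz2⟩ i
  rw [regBasis_apply, inner_liftV]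
  have hpol : (-(n:ℝ)) • w i ∈ polarSet (convexHull ℝ (range w)) := by
    intro y hy
    have : convexHull ℝ (range w) ⊆ {y | ⟪(-(n:ℝ)) • w i, y⟫ ≤ 1} := by
      refine convexHull_min ?_ ?_
      · rintro _ ⟨j, rfl⟩
        change ⟪(-(n:ℝ)) • w i, w j⟫ ≤ 1
        rw [real_inner_smul_left]
        by_cases hij : i = j
        · subst hij
          rw [real_inner_self_eq_norm_sq, hw.1]; linarith
        · rw [hw.2 i j hij]; field_simp; simp
      · exact convex_halfSpace_le (innerSL ℝ ((-(n:ℝ)) • w i)).isLinear 1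
    exact this hy
  have h2 := (inner_le_gauge ((hw.dec hn).nhds hn) hpol z.fst).trans hz2
  rw [real_inner_smul_left] at h2
  have h3 : 0 ≤ √n * ⟪w i, z.fst⟫ + z.snd := by
    have : 0 ≤ √(n:ℝ) * (√n * ⟪w i, z.fst⟫ + z.snd) := by
      rw [mul_add, ← mul_assoc, ← sq, h1]; linarith
    exact nonneg_of_mul_nonneg_right this hpos
  rw [div_mul_eq_mul_div, ← add_div]
  positivity

theorem ContactDec.exists_reg {n : ℕ} (hn : 1 ≤ n) {ι : Type} [Fintype ι]
    {u : ι → EuclideanSpace ℝ (Fin n)} {c : ι → ℝ} (h : ContactDec u c)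
    (hreg : ∀ i j, u i ≠ u j → ⟪u i, u j⟫ = -1 / n) :
    ∃ v : Fin (n + 1) → EuclideanSpace ℝ (Fin n), IsRegVerts v ∧ range v = range u := by
  classical
  have hn0 : (0:ℝ) < n := by exact_mod_cast hn
  have hfin : Fintype (range u) := Fintype.ofFinite _
  have horth : Orthonormal ℝ fun x : range u => liftV (x : EuclideanSpace ℝ (Fin n)) := by
    refine ⟨?_, ?_⟩
    · rintro ⟨_, i, rfl⟩
      exact norm_liftV _ (h.2.1 i)
    · rintro ⟨_, i, rfl⟩ ⟨_, j, rfl⟩ hij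
      change ⟪liftV (u i), liftV (u j)⟫ = 0
      have hij' : u i ≠ u j := fun hc => hij (Subtype.ext hc)
      rw [inner_liftV_liftV, hreg i j hij']
      field_simp
      simp
  have hspan : ⊤ ≤ Submodule.span ℝ (range fun x : range u => liftV (x : EuclideanSpace ℝ (Fin n))) := by
    intro z _
    rw [← h.lift_dec hn z]
    refine Submodule.sum_mem _ fun i _ => Submodule.smul_mem _ _ (Submodule.subset_span ?_)
    exact ⟨⟨u i, i, rfl⟩, rfl⟩
  have hcard : Fintype.card (range u) = n + 1 := by
    rw [← finrank_FF n, Module.finrank_eq_card_basis (Module.Basis.mk horth.linearIndependent hspan)]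
  let eq := (Fintype.equivFinOfCardEq hcard).symm
  refine ⟨fun k => (eq k : EuclideanSpace ℝ (Fin n)), ⟨fun k => ?_, fun k l hkl => ?_⟩, ?_⟩
  · obtain ⟨i, hi⟩ := (eq k).2
    change ‖(eq k : EuclideanSpace ℝ (Fin n))‖ = 1
    rw [← hi]; exact h.2.1 i
  · obtain ⟨i, hi⟩ := (eq k).2
    obtain ⟨j, hj⟩ := (eq l).2
    change ⟪(eq k : EuclideanSpace ℝ (Fin n)), (eq l : EuclideanSpace ℝ (Fin n))⟫ = _
    rw [← hi, ← hj]
    refine hreg i j ?_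
    rw [hi, hj]
    exact fun hc => hkl (eq.injective (Subtype.ext hc))
  · ext x
    constructor
    · rintro ⟨k, rfl⟩; exact (eq k).2
    · intro hx
      exact ⟨eq.symm ⟨x, hx⟩, by simp⟩

end piece7

section piece8

/-- Complementary region of the cone in the upper half space. -/
def Bset {n : ℕ} (L : Set (EuclideanSpace ℝ (Fin n))) :
    Set (WithLp 2 (EuclideanSpace ℝ (Fin n) × ℝ)) :=
  {z | 0 < z.snd ∧ √n * z.snd < gauge L z.fst}

def Bmass {n : ℕ} (L : Set (EuclideanSpace ℝ (Fin n))) (s : ℝ) : ℝ≥0∞ :=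
  ∫⁻ z in Bset L, ENNReal.ofReal (Real.exp (-‖z‖ ^ 2 / 2 + s * ⟪z, axisV n⟫))

def Jmass (n : ℕ) : ℝ≥0∞ := ∫⁻ s : ℝ, ENNReal.ofReal (Real.exp (-(√(n + 1) * s) ^ 2 / 2))

def Gmass {n : ℕ} (L : Set (EuclideanSpace ℝ (Fin n))) : ℝ≥0∞ :=
  ∫⁻ x, ENNReal.ofReal (gauge L x) ∂(gaussianM n)

variable {n : ℕ} {L : Set (EuclideanSpace ℝ (Fin n))}

theorem Bset_meas (hc : Convex ℝ L) (h0 : L ∈ nhds 0) : MeasurableSet (Bset L) := by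
  have := continuous_gauge hc h0
  refine (IsOpen.inter (s := {z : WithLp 2 (EuclideanSpace ℝ (Fin n) × ℝ) | 0 < z.snd})
    (t := {z : WithLp 2 (EuclideanSpace ℝ (Fin n) × ℝ) | √n * z.snd < gauge L z.fst}) ?_ ?_).measurableSet
  · exact isOpen_lt (by fun_prop) (by fun_prop)
  · exact isOpen_lt (by fun_prop) (by fun_prop)

theorem AB_sum (hc : Convex ℝ L) (h0 : L ∈ nhds 0) (s : ℝ) :
    Amass L s + Bmass L s = ∫⁻ z in {z : WithLp 2 (EuclideanSpace ℝ (Fin n) × ℝ) | 0 < z.snd},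
      ENNReal.ofReal (Real.exp (-‖z‖ ^ 2 / 2 + s * ⟪z, axisV n⟫)) := by
  unfold Amass Bmass
  rw [← lintegral_union (Bset_meas hc h0)]
  · congr 2
    ext z
    simp only [coneOf, Bset, mem_union, mem_ofPred_eq]
    rcases le_or_gt (gauge L z.fst) (√n * z.snd) with h | h
    · simp [h, not_lt.2 h]
    · simp [h, not_le.2 h]
  · rw [Set.disjoint_left]
    rintro z ⟨_, h⟩ ⟨_, h'⟩
    exact absurd h (not_le.2 h')

theorem Jmass_pos (n : ℕ) : Jmass n ≠ 0 := by
  unfold Jmass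
  rw [Ne, lintegral_eq_zero_iff (by fun_prop)]
  intro h
  rw [Filter.EventuallyEq, ae_iff] at h
  simp [Real.exp_pos, not_le] at h

theorem Jmass_fin (n : ℕ) : Jmass n ≠ ⊤ := by
  unfold Jmass
  have h : Integrable fun s : ℝ => Real.exp (-((n + 1)/2) * s ^ 2) :=
    integrable_exp_neg_mul_sq (by positivity)
  have := h.lintegral_lt_top
  refine ne_of_lt (lt_of_le_of_lt (lintegral_mono fun s => ?_) this)
  apply ENNReal.ofReal_le_ofReal
  apply Real.exp_le_exp.2
  rw [mul_pow, Real.sq_sqrt (by positivity)]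
  apply le_of_eq; ring

theorem Bint (hc : Convex ℝ L) (h0 : L ∈ nhds 0) :
    ∫⁻ s, Bmass L s * ENNReal.ofReal (Real.exp (-(n + 1) * s ^ 2 / 2))
      = Jmass n * ∫⁻ z in Bset L, ENNReal.ofReal (Real.exp (-‖z.fst‖ ^ 2 / 2)) := by
  unfold Bmass
  have hin : ∀ z : WithLp 2 (EuclideanSpace ℝ (Fin n) × ℝ),
      ⟪z, axisV n⟫ = √(n+1) * z.snd := inner_axisV
  simp_rw [hin]
  have e1 : ∀ s : ℝ, (∫⁻ z in Bset L, ENNReal.ofReal (Real.exp (-‖z‖ ^ 2 / 2 + s * (√(n+1) * z.snd))))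
      * ENNReal.ofReal (Real.exp (-(n + 1) * s ^ 2 / 2)) =
      ∫⁻ z in Bset L, ENNReal.ofReal (Real.exp (-‖z‖ ^ 2 / 2 + s * (√(n+1) * z.snd)))
      * ENNReal.ofReal (Real.exp (-(n + 1) * s ^ 2 / 2)) := by
    intro s
    rw [lintegral_mul_const _ (by fun_prop)]
  simp_rw [e1]
  rw [lintegral_lintegral_swap (by fun_prop)]
  rw [← lintegral_const_mul _ (by fun_prop)]
  refine lintegral_congr fun z => ?_
  have hs : (0:ℝ) < √(n+1) := by positivity
  have hs2 : √((n:ℝ)+1) ^ 2 = n + 1 := Real.sq_sqrt (by positivity)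
  have e2 : ∀ s : ℝ, ENNReal.ofReal (Real.exp (-‖z‖ ^ 2 / 2 + s * (√(n+1) * z.snd)))
      * ENNReal.ofReal (Real.exp (-(n + 1) * s ^ 2 / 2)) =
      ENNReal.ofReal (Real.exp (-(√(n + 1) * (s - z.snd / √(n+1))) ^ 2 / 2)) *
      ENNReal.ofReal (Real.exp (-‖z.fst‖ ^ 2 / 2)) := by
    intro s
    rw [← ENNReal.ofReal_mul (by positivity), ← ENNReal.ofReal_mul (by positivity), ← Real.exp_add,
      ← Real.exp_add, WithLp.prod_norm_sq_eq_of_L2]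
    congr 2
    rw [mul_sub, mul_div_cancel₀ _ hs.ne']
    simp only [Real.norm_eq_abs, sq_abs]
    linear_combination (-(s^2)/2) * hs2.symm
  simp_rw [e2]
  rw [lintegral_mul_const _ (by fun_prop)]
  congr 1
  exact lintegral_sub_right_eq_self (μ := volume)
    (fun s => ENNReal.ofReal (Real.exp (-(√(n + 1) * s) ^ 2 / 2))) _

theorem Bint2 (hn : 1 ≤ n) (hc : Convex ℝ L) (h0 : L ∈ nhds 0) :
    ∫⁻ z in Bset L, ENNReal.ofReal (Real.exp (-‖z.fst‖ ^ 2 / 2)) =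
    ∫⁻ x : EuclideanSpace ℝ (Fin n), ENNReal.ofReal (Real.exp (-‖x‖ ^ 2 / 2))
      * ENNReal.ofReal (gauge L x / √n) := by
  have hn0 : (0:ℝ) < √n := by
    have : (0:ℝ) < n := by exact_mod_cast hn
    positivity
  have hg := continuous_gauge hc h0
  rw [← lintegral_indicator (Bset_meas hc h0)]
  rw [← (WithLp.volume_preserving_toLp (EuclideanSpace ℝ (Fin n)) ℝ).lintegral_comp_emb
    (MeasurableEquiv.measurableEmbedding (MeasurableEquiv.toLp 2 _))]
  rw [Measure.volume_eq_prod, lintegral_prod _ ?_]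
  · refine lintegral_congr fun x => ?_
    have : ∀ r : ℝ, (Bset L).indicator (fun z => ENNReal.ofReal (Real.exp (-‖z.fst‖ ^ 2 / 2)))
        (WithLp.toLp 2 (x, r)) = (Ioo 0 (gauge L x / √n)).indicator
          (fun _ => ENNReal.ofReal (Real.exp (-‖x‖ ^ 2 / 2))) r := by
      intro r
      unfold indicator
      have : (WithLp.toLp 2 (x, r) ∈ Bset L) ↔ r ∈ Ioo 0 (gauge L x / √n) := by
        simp only [mem_Ioo, lt_div_iff₀ hn0, mul_comm r]
        exact Iff.rfl
      simp only [this]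
      rfl
    simp_rw [this]
    rw [lintegral_indicator measurableSet_Ioo]
    simp
  · have h1 : Measurable ((Bset L).indicator
      (fun z => ENNReal.ofReal (Real.exp (-‖z.fst‖ ^ 2 / 2)))) :=
      Measurable.indicator (by fun_prop) (Bset_meas hc h0)
    exact (h1.comp (WithLp.measurable_toLp 2 _)).aemeasurable

/-- The normalising constant. -/
theorem Gmass_eq (hn : 1 ≤ n) (hc : Convex ℝ L) (h0 : L ∈ nhds 0) :
    ENNReal.ofReal ((2 * Real.pi) ^ (-(n : ℝ) / 2) * √n) *
      ∫⁻ s, Bmass L s * ENNReal.ofReal (Real.exp (-(n + 1) * s ^ 2 / 2)) = Jmass n * Gmass L := by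
  have hn0 : (0:ℝ) < √n := by
    have : (0:ℝ) < n := by exact_mod_cast hn
    positivity
  have hg := continuous_gauge hc h0
  rw [Bint hc h0, Bint2 hn hc h0, mul_left_comm]
  congr 1
  unfold Gmass gaussianM
  rw [lintegral_withDensity_eq_lintegral_mul _ (by fun_prop) (by fun_prop),
    ← lintegral_const_mul _ (by fun_prop)]
  refine lintegral_congr fun x => ?_
  rw [Pi.mul_apply]
  rw [← ENNReal.ofReal_mul (by positivity), ← ENNReal.ofReal_mul (by positivity),
    ← ENNReal.ofReal_mul (by positivity)]
  congr 1
  field_simp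

theorem gaussian_exp_int (n : ℕ) (b : ℝ) (hb : 0 < b) :
    Integrable fun x : EuclideanSpace ℝ (Fin n) => Real.exp (-b * ‖x‖ ^ 2) := by
  have := GaussianFourier.integrable_cexp_neg_mul_sq_norm_add (V := EuclideanSpace ℝ (Fin n))
    (b := b) (by simpa using hb) 0 0
  simp at this
  have h2 := this.re
  refine h2.congr (Filter.Eventually.of_forall fun x => ?_)
  have : (-((b:ℂ) * (‖x‖:ℂ) ^ 2)) = ((-b * ‖x‖ ^ 2 : ℝ) : ℂ) := by push_cast; ring
  simp only [RCLike.re_to_complex]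
  rw [this, Complex.exp_ofReal_re]

theorem gauge_le_mul_norm (h0 : L ∈ nhds 0) : ∃ C : ℝ, 0 ≤ C ∧ ∀ x, gauge L x ≤ C * ‖x‖ := by
  obtain ⟨r, hr, hs⟩ := Metric.mem_nhds_iff.1 h0
  refine ⟨r⁻¹, by positivity, fun x => ?_⟩
  have := gauge_mono (absorbent_ball_zero hr) hs x
  rw [gauge_ball hr.le] at this
  rw [inv_mul_eq_div]; exact this

instance gaussianM_finite (n : ℕ) : IsFiniteMeasure (gaussianM n) := by
  refine isFiniteMeasure_withDensity_ofReal ?_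
  have := (gaussian_exp_int n (1/2) (by norm_num)).const_mul ((2 * Real.pi) ^ (-(n : ℝ) / 2))
  refine (this.congr (Filter.Eventually.of_forall fun x => ?_)).2
  simp only
  congr 2; ring

theorem norm_int_gaussian (n : ℕ) : Integrable (fun x => ‖x‖) (gaussianM n) := by
  unfold gaussianM
  rw [integrable_withDensity_iff (by fun_prop) (Filter.Eventually.of_forall fun x => by simp)]
  have h1 := (gaussian_exp_int n (1/4) (by norm_num)).const_mul (2 * (2 * Real.pi) ^ (-(n : ℝ) / 2))
  refine h1.mono' (by fun_prop) (Filter.Eventually.of_forall fun x => ?_)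
  rw [ENNReal.toReal_ofReal (by positivity), Real.norm_of_nonneg (by positivity)]
  have e : Real.exp (-‖x‖ ^ 2 / 2) = Real.exp (-(1/4) * ‖x‖^2) * Real.exp (-(1/4) * ‖x‖^2) := by
    rw [← Real.exp_add]; congr 1; ring
  have e2 : ‖x‖ * Real.exp (-(1/4) * ‖x‖^2) ≤ 2 := by
    have h3 : ‖x‖ ≤ 2 * Real.exp ((1/4) * ‖x‖^2) := by
      have := Real.add_one_le_exp ((1/4) * ‖x‖^2)
      nlinarith [sq_nonneg (‖x‖ - 2)]
    calc _ ≤ 2 * Real.exp ((1/4) * ‖x‖^2) * Real.exp (-(1/4) * ‖x‖^2) := by gcongr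
      _ = 2 := by rw [mul_assoc, ← Real.exp_add]; ring_nf; simp
  rw [e]
  have hp : 0 ≤ (2 * Real.pi) ^ (-(n : ℝ) / 2) * Real.exp (-(1/4) * ‖x‖^2) := by positivity
  nlinarith [mul_le_mul_of_nonneg_left e2 hp]

theorem gauge_int_gaussian (hc : Convex ℝ L) (h0 : L ∈ nhds 0) :
    Integrable (gauge L) (gaussianM n) := by
  obtain ⟨C, hC, h⟩ := gauge_le_mul_norm h0
  refine ((norm_int_gaussian n).const_mul C).mono' (continuous_gauge hc h0).aestronglyMeasurable
    (Filter.Eventually.of_forall fun x => ?_)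
  rw [Real.norm_of_nonneg (gauge_nonneg _)]
  exact h x

theorem Gmass_fin (hc : Convex ℝ L) (h0 : L ∈ nhds 0) : Gmass L ≠ ⊤ :=
  (gauge_int_gaussian hc h0).lintegral_lt_top.ne

theorem ellNorm_eq (hc : Convex ℝ L) (h0 : L ∈ nhds 0) : ellNorm n L = (Gmass L).toReal := by
  unfold ellNorm Gmass
  rw [integral_eq_lintegral_of_nonneg_ae (Filter.Eventually.of_forall fun x => gauge_nonneg _)
    (continuous_gauge hc h0).aestronglyMeasurable]

end piece8

section piece9

section core
variable {n : ℕ} {ι : Type} [Fintype ι] {u : ι → EuclideanSpace ℝ (Fin n)} {c : ι → ℝ}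
  {w : Fin (n + 1) → EuclideanSpace ℝ (Fin n)}

theorem Bmass_meas (L : Set (EuclideanSpace ℝ (Fin n))) : Measurable (Bmass L) := by
  unfold Bmass
  refine Measurable.lintegral_prod_right'
    (f := fun p : ℝ × WithLp 2 (EuclideanSpace ℝ (Fin n) × ℝ) =>
      ENNReal.ofReal (Real.exp (-‖p.2‖ ^ 2 / 2 + p.1 * ⟪p.2, axisV n⟫))) ?_
  exact ENNReal.measurable_ofReal.comp (Continuous.measurable (by fun_prop))

theorem B_le (hn : 1 ≤ n) (h : ContactDec u c) (hw : IsRegVerts w) (s : ℝ) :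
    Bmass (convexHull ℝ (range u)) s ≤ Bmass (convexHull ℝ (range w)) s := by
  have e := (AB_sum (convex_convexHull ℝ (range u)) (h.nhds hn) s).trans
    (AB_sum (convex_convexHull ℝ (range w)) ((hw.dec hn).nhds hn) s).symm
  have h1 := h.A_lower hn s
  have h2 := hw.A_upper hn s
  have hfin : Amass (convexHull ℝ (range w)) s ≠ ⊤ := ne_top_of_le_ne_top ENNReal.ofReal_ne_top h2
  refine (ENNReal.add_le_add_iff_left hfin).1 ?_
  rw [← e]
  gcongr
  exact h2.trans h1

theorem G_le (hn : 1 ≤ n) (h : ContactDec u c) (hw : IsRegVerts w) :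
    Gmass (convexHull ℝ (range u)) ≤ Gmass (convexHull ℝ (range w)) := by
  have e1 := Gmass_eq hn (convex_convexHull ℝ (range u)) (h.nhds hn)
  have e2 := Gmass_eq hn (convex_convexHull ℝ (range w)) ((hw.dec hn).nhds hn)
  refine (ENNReal.mul_le_mul_iff_right (Jmass_pos n) (Jmass_fin n)).1 ?_
  rw [← e1, ← e2]
  gcongr with s
  exact B_le hn h hw s

theorem G_eq (hn : 1 ≤ n) (h : ContactDec u c) (hw : IsRegVerts w)
    (hG : Gmass (convexHull ℝ (range w)) ≤ Gmass (convexHull ℝ (range u))) :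
    ∃ v : Fin (n + 1) → EuclideanSpace ℝ (Fin n), IsRegVerts v ∧ range v = range u := by
  have hn0 : (0:ℝ) < n := by exact_mod_cast hn
  have e1 := Gmass_eq hn (convex_convexHull ℝ (range u)) (h.nhds hn)
  have e2 := Gmass_eq hn (convex_convexHull ℝ (range w)) ((hw.dec hn).nhds hn)
  have hc0 : ENNReal.ofReal ((2 * Real.pi) ^ (-(n : ℝ) / 2) * √n) ≠ 0 := by
    have : 0 < (2 * Real.pi) ^ (-(n : ℝ) / 2) * √n := by positivity
    simpa using this
  have hle : ∫⁻ s, Bmass (convexHull ℝ (range w)) s * ENNReal.ofReal (Real.exp (-(n + 1) * s ^ 2 / 2))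
      ≤ ∫⁻ s, Bmass (convexHull ℝ (range u)) s * ENNReal.ofReal (Real.exp (-(n + 1) * s ^ 2 / 2)) := by
    refine (ENNReal.mul_le_mul_iff_right hc0 ENNReal.ofReal_ne_top).1 ?_
    rw [e1, e2]
    gcongr
  have hfin : ∫⁻ s, Bmass (convexHull ℝ (range u)) s * ENNReal.ofReal (Real.exp (-(n + 1) * s ^ 2 / 2))
      ≠ ⊤ := by
    intro hc
    rw [hc, ENNReal.mul_top hc0] at e1
    exact ENNReal.mul_ne_top (Jmass_fin n)
      (Gmass_fin (convex_convexHull ℝ (range u)) (h.nhds hn)) e1.symm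
  have hm : ∀ L : Set (EuclideanSpace ℝ (Fin n)), Measurable fun s =>
      Bmass L s * ENNReal.ofReal (Real.exp (-(n + 1) * s ^ 2 / 2)) :=
    fun L => (Bmass_meas L).mul (by fun_prop)
  have hae := ae_eq_of_ae_le_of_lintegral_le
    (Filter.Eventually.of_forall fun s => by
      exact mul_le_mul_left (B_le hn h hw s) (ENNReal.ofReal (Real.exp (-(n + 1) * s ^ 2 / 2)))) hfin (hm _).aemeasurable hle
  have hlt := ae_lt_top' (hm (convexHull ℝ (range u))).aemeasurable hfin
  obtain ⟨s, hs1, hs2⟩ := (hae.and hlt).exists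
  have hw0 : ENNReal.ofReal (Real.exp (-(n + 1) * s ^ 2 / 2)) ≠ 0 := by
    simpa using Real.exp_pos _
  have hB : Bmass (convexHull ℝ (range u)) s = Bmass (convexHull ℝ (range w)) s :=
    (ENNReal.mul_left_inj hw0 ENNReal.ofReal_ne_top).1 hs1
  have hBf : Bmass (convexHull ℝ (range w)) s ≠ ⊤ := by
    rw [← hB]
    intro hc
    rw [hc, ENNReal.top_mul hw0] at hs2
    exact lt_irrefl _ hs2
  have e := (AB_sum (convex_convexHull ℝ (range u)) (h.nhds hn) s).trans
    (AB_sum (convex_convexHull ℝ (range w)) ((hw.dec hn).nhds hn) s).symm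
  rw [hB] at e
  have hA := (ENNReal.add_left_inj hBf).1 e
  exact h.exists_reg hn fun i j hij => h.A_eq hn s (hA.le.trans (hw.A_upper hn s)) i j hij

theorem ellNorm_reg_eq {v : Fin (n + 1) → EuclideanSpace ℝ (Fin n)} (hn : 1 ≤ n) (hv : IsRegVerts v)
    (hw : IsRegVerts w) :
    ellNorm n (convexHull ℝ (range v)) = ellNorm n (convexHull ℝ (range w)) := by
  rw [ellNorm_eq (convex_convexHull ℝ (range v)) ((hv.dec hn).nhds hn),
    ellNorm_eq (convex_convexHull ℝ (range w)) ((hw.dec hn).nhds hn)]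
  congr 1
  exact le_antisymm (G_le hn (hv.dec hn) hw) (G_le hn (hw.dec hn) hv)

theorem gaussianM_abs (n : ℕ) : (volume : Measure (EuclideanSpace ℝ (Fin n))) ≪ gaussianM n := by
  refine withDensity_absolutelyContinuous' (by fun_prop) (Filter.Eventually.of_forall fun x => ?_)
  have : 0 < (2 * Real.pi) ^ (-(n : ℝ) / 2) * Real.exp (-‖x‖ ^ 2 / 2) := by positivity
  simpa using this

theorem core_le (hn : 1 ≤ n) (h : ContactDec u c) (hw : IsRegVerts w)
    {M : Set (EuclideanSpace ℝ (Fin n))} (hMc : IsClosed M) (hMv : Convex ℝ M)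
    (hu : range u ⊆ M) :
    ellNorm n M ≤ ellNorm n (convexHull ℝ (range w)) ∧
      (ellNorm n M = ellNorm n (convexHull ℝ (range w)) ↔
        ∃ v : Fin (n + 1) → EuclideanSpace ℝ (Fin n),
          IsRegVerts v ∧ M = convexHull ℝ (Set.range v)) := by
  have hL0 := h.nhds hn
  have hLc := convex_convexHull ℝ (range u)
  have hLM : convexHull ℝ (range u) ⊆ M := convexHull_min hu hMv
  have hM0 : M ∈ nhds 0 := Filter.mem_of_superset hL0 hLM
  have hgle : ∀ x, gauge M x ≤ gauge (convexHull ℝ (range u)) x :=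
    fun x => gauge_mono (absorbent_nhds_zero hL0) hLM x
  have hi1 := gauge_int_gaussian hMv hM0
  have hi2 := gauge_int_gaussian hLc hL0
  have h1 : ellNorm n M ≤ ellNorm n (convexHull ℝ (range u)) := integral_mono hi1 hi2 hgle
  have h2 : ellNorm n (convexHull ℝ (range u)) ≤ ellNorm n (convexHull ℝ (range w)) := by
    rw [ellNorm_eq hLc hL0, ellNorm_eq (convex_convexHull ℝ (range w)) ((hw.dec hn).nhds hn)]
    exact ENNReal.toReal_mono
      (Gmass_fin (convex_convexHull ℝ (range w)) ((hw.dec hn).nhds hn)) (G_le hn h hw)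
  refine ⟨h1.trans h2, fun heq => ?_, ?_⟩
  · have h3 : ellNorm n (convexHull ℝ (range w)) ≤ ellNorm n (convexHull ℝ (range u)) := heq ▸ h1
    have h4 : ellNorm n M = ellNorm n (convexHull ℝ (range u)) := le_antisymm h1 (h2.trans heq.ge)
    rw [ellNorm_eq hLc hL0, ellNorm_eq (convex_convexHull ℝ (range w)) ((hw.dec hn).nhds hn),
      ENNReal.toReal_le_toReal (Gmass_fin (convex_convexHull ℝ (range w)) ((hw.dec hn).nhds hn))
      (Gmass_fin hLc hL0)] at h3
    obtain ⟨v, hv, hvr⟩ := G_eq hn h hw h3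
    refine ⟨v, hv, ?_⟩
    rw [hvr]
    refine subset_antisymm ?_ hLM
    have hae : gauge M =ᵐ[gaussianM n] gauge (convexHull ℝ (range u)) :=
      (integral_eq_iff_of_ae_le hi1 hi2 (Filter.Eventually.of_forall hgle)).1 h4
    have hae2 : gauge M =ᵐ[volume] gauge (convexHull ℝ (range u)) := (gaussianM_abs n).ae_le hae
    have hfe := (continuous_gauge hMv hM0).ae_eq_iff_eq volume (continuous_gauge hLc hL0) |>.1 hae2
    intro x hx
    have hx1 : gauge M x ≤ 1 := gauge_le_one_of_mem hx
    rw [hfe] at hx1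
    have hcl : IsClosed (convexHull ℝ (range u)) :=
      ((Set.finite_range u).isCompact_convexHull (𝕜 := ℝ)).isClosed
    have := (gauge_le_one_iff_mem_closure hLc hL0).1 hx1
    rwa [hcl.closure_eq] at this
  · rintro ⟨v, hv, rfl⟩
    exact ellNorm_reg_eq hn hv hw

end core

end piece9

section piece10

theorem compact_convexHull {V : Type*} [NormedAddCommGroup V] [NormedSpace ℝ V]
    [FiniteDimensional ℝ V] {S : Set V} (hS : IsCompact S) : IsCompact (convexHull ℝ S) := by
  rcases S.eq_empty_or_nonempty with rfl | ⟨s0, hs0⟩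
  · simp
  set N := Module.finrank ℝ V + 1 with hN
  have hc : IsCompact ((fun p : (Fin N → ℝ) × (Fin N → V) => ∑ i, p.1 i • p.2 i) ''
      (stdSimplex ℝ (Fin N) ×ˢ Set.pi univ fun _ => S)) :=
    ((isCompact_stdSimplex ℝ (Fin N)).prod (isCompact_univ_pi fun _ => hS)).image (by fun_prop)
  convert hc using 1
  refine subset_antisymm ?_ ?_
  · intro x hx
    obtain ⟨ι, hι, z, wt, hz, haff, hwt, hsum1, hsum⟩ := eq_pos_convex_span_of_mem_convexHull hx
    have hcard : Fintype.card ι ≤ Fintype.card (Fin N) := by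
      rw [Fintype.card_fin]
      refine haff.card_le_finrank_succ.trans ?_
      rw [hN]
      gcongr
      exact Submodule.finrank_le _
    obtain ⟨e⟩ := Function.Embedding.nonempty_of_card_le hcard
    refine ⟨(Function.extend e wt 0, Function.extend e z fun _ => s0), ⟨⟨fun k => ?_, ?_⟩, fun k _ => ?_⟩, ?_⟩
    · by_cases hk : ∃ i, e i = k
      · obtain ⟨i, rfl⟩ := hk
        simp only [e.injective.extend_apply]
        exact (hwt i).le
      · simp [Function.extend_apply' _ _ _ hk]
    · rw [← hsum1]
      refine (Fintype.sum_of_injective e e.injective _ _ (fun k hk => ?_) fun i => ?_).symm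
      · exact Function.extend_apply' _ _ _ hk
      · exact (e.injective.extend_apply _ _ _).symm
    · by_cases hk : ∃ i, e i = k
      · obtain ⟨i, rfl⟩ := hk
        simp only [e.injective.extend_apply]
        exact hz ⟨i, rfl⟩
      · simp only [Function.extend_apply' _ _ _ hk]
        exact hs0
    · rw [← hsum]
      refine (Fintype.sum_of_injective e e.injective _ _ (fun k hk => ?_) fun i => ?_).symm
      · simp only
        rw [Function.extend_apply' _ _ _ hk]; simp
      · simp only [e.injective.extend_apply]
  · rintro _ ⟨⟨w, z⟩, ⟨⟨hw0, hw1⟩, hz⟩, rfl⟩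
    exact (convex_convexHull ℝ S).sum_mem (fun i _ => hw0 i) hw1
      fun i _ => subset_convexHull ℝ S (hz i (mem_univ i))

section john
variable {n : ℕ}

/-- outer square of a vector together with the vector. -/
def sqMap (x : EuclideanSpace ℝ (Fin n)) : (Fin n → Fin n → ℝ) × EuclideanSpace ℝ (Fin n) :=
  (fun i j => x i * x j, x)

theorem toEuclideanLin_coord (A : Matrix (Fin n) (Fin n) ℝ) (x : EuclideanSpace ℝ (Fin n)) :
    ⟪Matrix.toEuclideanLin A x, x⟫ = ∑ i, ∑ j, x i * x j * A i j := by
  simp only [PiLp.inner_apply, Matrix.ofLp_toLpLin, Matrix.toLin'_apply, Matrix.mulVec, dotProduct, RCLike.inner_apply,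
    conj_trivial]
  refine Finset.sum_congr rfl fun i _ => ?_
  rw [Finset.mul_sum]
  exact Finset.sum_congr rfl fun j _ => by ring

theorem john_alt (hn : 1 ≤ n) {M : Set (EuclideanSpace ℝ (Fin n))} (hM : IsCompact M) :
    (∃ (ι : Type) (_ : Fintype ι) (u : ι → EuclideanSpace ℝ (Fin n)) (c : ι → ℝ),
      ContactDec u c ∧ range u ⊆ M) ∨
    ∃ (A : Matrix (Fin n) (Fin n) ℝ) (a : EuclideanSpace ℝ (Fin n)), 0 < A.trace ∧
      ∀ y ∈ M, ‖y‖ = 1 → ⟪Matrix.toEuclideanLin A y, y⟫ + ⟪a, y⟫ < 0 := by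
  have hn0 : (0:ℝ) < n := by exact_mod_cast hn
  have hcont : Continuous (sqMap (n := n)) := by unfold sqMap; fun_prop
  have hS : IsCompact (sqMap '' (M ∩ sphere (0 : EuclideanSpace ℝ (Fin n)) 1)) :=
    (hM.inter_right isClosed_sphere).image hcont
  set p : (Fin n → Fin n → ℝ) × EuclideanSpace ℝ (Fin n) :=
    (fun i j => if i = j then 1 / (n:ℝ) else 0, 0) with hp
  by_cases hmem : p ∈ convexHull ℝ (sqMap '' (M ∩ sphere (0 : EuclideanSpace ℝ (Fin n)) 1))
  · left
    obtain ⟨ι, hι, z, wt, hz, -, hwt, -, hsum⟩ := eq_pos_convex_span_of_mem_convexHull hmem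
    have hz' : ∀ i, ∃ x, x ∈ M ∩ sphere (0 : EuclideanSpace ℝ (Fin n)) 1 ∧ sqMap x = z i :=
      fun i => hz ⟨i, rfl⟩
    choose u hu hzu using hz'
    have h2 : ∑ i, wt i • u i = 0 := by
      have := congrArg Prod.snd hsum
      rw [Prod.snd_sum] at this
      simpa [← hzu, sqMap] using this
    have h1 : ∀ j k, ∑ i, wt i * (u i j * u i k) = if j = k then 1 / (n:ℝ) else 0 := by
      intro j k
      have := congrFun (congrFun (congrArg Prod.fst hsum) j) k
      rw [Prod.fst_sum, Finset.sum_apply, Finset.sum_apply] at this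
      simpa [← hzu, sqMap, hp] using this
    refine ⟨ι, hι, u, fun i => n * wt i, ⟨fun i => mul_pos hn0 (hwt i), fun i => by simpa using (hu i).2,
      ?_, fun x => ?_⟩, ?_⟩
    · simp_rw [mul_smul, ← Finset.smul_sum, h2, smul_zero]
    · ext k
      have e : ∀ i, (((n:ℝ) * wt i * ⟪u i, x⟫) • u i) k =
          ∑ j, n * x j * (wt i * (u i j * u i k)) := by
        intro i
        simp only [PiLp.smul_apply, PiLp.inner_apply, RCLike.inner_apply, conj_trivial, smul_eq_mul]
        rw [Finset.mul_sum, Finset.sum_mul]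
        exact Finset.sum_congr rfl fun j _ => by ring
      simp only [WithLp.ofLp_sum, Finset.sum_apply]
      rw [Finset.sum_congr rfl fun i _ => e i, Finset.sum_comm]
      simp_rw [← Finset.mul_sum, h1]
      simp
      field_simp
    · rintro _ ⟨i, rfl⟩; exact (hu i).1
  · right
    obtain ⟨f, r, hf1, hf2⟩ := geometric_hahn_banach_closed_point (convex_convexHull ℝ _)
      (compact_convexHull hS).isClosed hmem
    let A0 : Matrix (Fin n) (Fin n) ℝ := fun i j => f (Pi.single i (Pi.single j 1), 0)
    let a := (InnerProductSpace.toDual ℝ (EuclideanSpace ℝ (Fin n))).symm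
      (f.comp (ContinuousLinearMap.inr ℝ _ _))
    have hfe : ∀ (m : Fin n → Fin n → ℝ) x, f (m, x) = ∑ i, ∑ j, m i j * A0 i j + ⟪a, x⟫ := by
      intro m x
      have e1 : ⟪a, x⟫ = f (0, x) := by
        simp [a]
      have e2 : f (m, 0) = ∑ i, ∑ j, m i j * A0 i j := by
        have : (m, (0 : EuclideanSpace ℝ (Fin n))) = ∑ i, ∑ j, m i j •
            ((Pi.single i (Pi.single j 1), 0) : (Fin n → Fin n → ℝ) × EuclideanSpace ℝ (Fin n)) := by
          refine Prod.ext ?_ ?_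
          · simp only [Prod.fst_sum, Prod.smul_fst]
            funext k l
            simp only [Finset.sum_apply, Pi.smul_apply, smul_eq_mul]
            simp [Pi.single_apply, ite_apply]
          · simp [Prod.snd_sum]
        rw [this]
        simp only [map_sum, map_smul, smul_eq_mul]
        rfl
      rw [e1, ← e2, ← map_add]
      simp
    refine ⟨A0 - r • 1, a, ?_, fun y hy hy1 => ?_⟩
    · rw [hp, hfe] at hf2
      simp only [ite_mul, zero_mul, Finset.sum_ite_eq, Finset.mem_univ, if_true, inner_zero_right,
        add_zero, ← Finset.mul_sum] at hf2
      rw [Matrix.trace_sub, Matrix.trace_smul, Matrix.trace_one]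
      have : r < 1 / n * A0.trace := hf2
      simp only [Fintype.card_fin, smul_eq_mul]
      have h3 := mul_lt_mul_of_pos_right this hn0
      field_simp at h3
      linarith
    · have h3 := hf1 _ (subset_convexHull ℝ _ ⟨y, ⟨hy, by simpa using hy1⟩, rfl⟩)
      rw [sqMap, hfe] at h3
      rw [map_sub, map_smul, LinearMap.sub_apply, LinearMap.smul_apply, inner_sub_left, toEuclideanLin_coord]
      have : Matrix.toEuclideanLin (1 : Matrix (Fin n) (Fin n) ℝ) y = y := by
        simp [Matrix.toEuclideanLin]
      rw [this, real_inner_smul_left, real_inner_self_eq_norm_sq, hy1]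
      linarith

theorem perturb {E : Type*} [NormedAddCommGroup E] {M : Set E} (hM : IsCompact M)
    (hMb : M ⊆ closedBall 0 1)
    (φ : E → ℝ) (hφ : Continuous φ) (hneg : ∀ y ∈ M, ‖y‖ = 1 → φ y < 0) (C : ℝ) :
    ∀ᶠ δ in nhdsWithin (0:ℝ) (Ioi 0), ∀ y ∈ M, ‖y‖ ^ 2 + 2 * δ * φ y + δ ^ 2 * C ≤ 1 := by
  rcases M.eq_empty_or_nonempty with rfl | hne
  · simp
  obtain ⟨y0, hy0, hmin⟩ := hM.exists_isMinOn hne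
    (f := fun y => max (-φ y) (1 - ‖y‖ ^ 2)) (by fun_prop)
  obtain ⟨D, hD⟩ := hM.exists_bound_of_continuousOn hφ.continuousOn
  set m := max (-φ y0) (1 - ‖y0‖ ^ 2) with hm
  have hm0 : 0 < m := by
    have h1 : ‖y0‖ ≤ 1 := by simpa using hMb hy0
    rcases h1.lt_or_eq with h | h
    · exact lt_max_of_lt_right (by nlinarith [norm_nonneg y0])
    · exact lt_max_of_lt_left (by linarith [hneg y0 hy0 h])
  have ev1 : ∀ᶠ δ in nhdsWithin (0:ℝ) (Ioi 0), δ * C < 2 * m := by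
    refine nhdsWithin_le_nhds ?_
    have : Filter.Tendsto (fun δ : ℝ => δ * C) (nhds 0) (nhds (0 * C)) :=
      (continuous_id.mul continuous_const).tendsto 0
    exact this.eventually_lt_const (by simpa using hm0)
  have ev2 : ∀ᶠ δ in nhdsWithin (0:ℝ) (Ioi 0), 2 * δ * D + δ ^ 2 * C < m := by
    refine nhdsWithin_le_nhds ?_
    have : Filter.Tendsto (fun δ : ℝ => 2 * δ * D + δ ^ 2 * C) (nhds 0)
        (nhds (2 * 0 * D + 0 ^ 2 * C)) :=
      Continuous.tendsto (by fun_prop) 0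
    exact this.eventually_lt_const (by simpa using hm0)
  filter_upwards [ev1, ev2, self_mem_nhdsWithin] with δ h1 h2 hδ y hy
  have hδ : 0 < δ := hδ
  have hy1 : ‖y‖ ≤ 1 := by simpa using hMb hy
  have hmy : m ≤ max (-φ y) (1 - ‖y‖ ^ 2) := hmin hy
  rcases le_max_iff.1 hmy with h | h
  · nlinarith [norm_nonneg y]
  · have := (abs_le.1 (hD y hy)).2
    nlinarith

theorem det_gt (A : Matrix (Fin n) (Fin n) ℝ) (hA : 0 < A.trace) :
    ∀ᶠ δ in nhdsWithin (0:ℝ) (Ioi 0), 1 < LinearMap.det (Matrix.toEuclideanLin (1 + δ • A)) := by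
  have e : ∀ B : Matrix (Fin n) (Fin n) ℝ, LinearMap.det (Matrix.toEuclideanLin B) = B.det := by
    intro B
    rw [Matrix.toEuclideanLin_eq_toLin_orthonormal, LinearMap.det_toLin]
  simp_rw [e]
  set P := (Matrix.det (1 + (Polynomial.X : Polynomial ℝ) • A.map Polynomial.C)).divX.divX with hP
  have : Filter.Tendsto (fun δ : ℝ => A.trace + P.eval δ * δ) (nhds 0)
        (nhds (A.trace + P.eval 0 * 0)) :=
      Continuous.tendsto (by fun_prop) 0
  filter_upwards [nhdsWithin_le_nhds (this.eventually_const_lt (u := 0) (by simpa using hA)),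
    self_mem_nhdsWithin] with δ h1 hδ
  have hδ : 0 < δ := hδ
  rw [Matrix.det_one_add_smul, ← hP]
  nlinarith

theorem vol_affine (T : EuclideanSpace ℝ (Fin n) →ₗ[ℝ] EuclideanSpace ℝ (Fin n))
    (b : EuclideanSpace ℝ (Fin n)) (s : Set (EuclideanSpace ℝ (Fin n))) :
    volume ((fun x => T x + b) '' s) = ENNReal.ofReal |LinearMap.det T| * volume s := by
  rw [← Measure.addHaar_image_linearMap, ← measure_vadd volume b (T '' s)]
  congr 1
  ext x
  simp only [mem_image, Set.mem_vadd_set]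
  constructor
  · rintro ⟨y, hy, rfl⟩
    exact ⟨T y, ⟨y, hy, rfl⟩, by rw [vadd_eq_add, add_comm]⟩
  · rintro ⟨_, ⟨y, hy, rfl⟩, rfl⟩
    exact ⟨y, hy, by rw [vadd_eq_add, add_comm]⟩

/-- The affine equivalence x ↦ T x + b. -/
def affMk (T : EuclideanSpace ℝ (Fin n) →ₗ[ℝ] EuclideanSpace ℝ (Fin n)) (hT : LinearMap.det T ≠ 0)
    (b : EuclideanSpace ℝ (Fin n)) :
    EuclideanSpace ℝ (Fin n) ≃ᵃ[ℝ] EuclideanSpace ℝ (Fin n) :=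
  (T.equivOfDetNeZero hT).toAffineEquiv.trans (AffineEquiv.constVAdd ℝ _ b)

theorem affMk_apply (T : EuclideanSpace ℝ (Fin n) →ₗ[ℝ] EuclideanSpace ℝ (Fin n))
    (hT : LinearMap.det T ≠ 0) (b x : EuclideanSpace ℝ (Fin n)) : affMk T hT b x = T x + b := by
  simp [affMk, add_comm]

theorem lin_apply (A : Matrix (Fin n) (Fin n) ℝ) (δ : ℝ) (x : EuclideanSpace ℝ (Fin n)) :
    Matrix.toEuclideanLin (1 + δ • A) x = x + δ • Matrix.toEuclideanLin A x := by
  have : Matrix.toEuclideanLin (1 : Matrix (Fin n) (Fin n) ℝ) x = x := by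
    simp [Matrix.toEuclideanLin]
  rw [map_add, map_smul, LinearMap.add_apply, LinearMap.smul_apply, this]

theorem ball_vol_contra {d : ℝ} (hd : 1 < d) {V : ℝ≥0∞}
    (h : ENNReal.ofReal |d| * V ≤ V) (h0 : V ≠ 0) (ht : V ≠ ⊤) : False := by
  have h1 : ENNReal.ofReal |d| * V ≤ 1 * V := by simpa using h
  rw [ENNReal.mul_le_mul_iff_left h0 ht, abs_of_pos (by linarith)] at h1
  rw [ENNReal.ofReal_le_one] at h1
  linarith

theorem loewner_contact (hn : 1 ≤ n) {K : Set (EuclideanSpace ℝ (Fin n))} (hK : IsCompact K)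
    (h : IsLoewnerEllipsoid (closedBall (0 : EuclideanSpace ℝ (Fin n)) 1) K) :
    ∃ (ι : Type) (_ : Fintype ι) (u : ι → EuclideanSpace ℝ (Fin n)) (c : ι → ℝ),
      ContactDec u c ∧ range u ⊆ K := by
  rcases john_alt hn hK with h1 | ⟨A, a, htr, hneg⟩
  · exact h1
  exfalso
  set T := Matrix.toEuclideanLin A with hT
  have hTc : Continuous T := T.continuous_of_finiteDimensional
  obtain ⟨C, hC⟩ := hK.exists_bound_of_continuousOn (f := fun x => ‖T x + a‖ ^ 2) (by fun_prop)
  obtain ⟨δ, hp, hd, hδ⟩ := ((perturb hK h.2.1 (fun y => ⟪T y, y⟫ + ⟪a, y⟫) (by fun_prop) hneg C).and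
    ((det_gt A htr).and self_mem_nhdsWithin)).exists
  have hδ : 0 < δ := hδ
  have hdet : LinearMap.det (Matrix.toEuclideanLin (1 + δ • A)) ≠ 0 := by linarith
  set g := affMk _ hdet (δ • a) with hg
  have hsub : K ⊆ g.symm '' closedBall 0 1 := by
    intro x hx
    refine ⟨g x, ?_, by simp⟩
    rw [mem_closedBall_zero_iff, hg, affMk_apply, lin_apply]
    have h2 := hp x hx
    have h3 := (abs_le.1 (hC x hx)).2
    have e : ‖x + δ • T x + δ • a‖ ^ 2 = ‖x‖ ^ 2 + 2 * δ * (⟪T x, x⟫ + ⟪a, x⟫)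
        + δ ^ 2 * ‖T x + a‖ ^ 2 := by
      rw [add_assoc, ← smul_add, norm_add_sq_real, norm_smul, mul_pow, Real.norm_eq_abs, sq_abs,
        real_inner_smul_right, inner_add_right, real_inner_comm x, real_inner_comm x]
      ring
    have : ‖x + δ • T x + δ • a‖ ^ 2 ≤ 1 := by rw [e]; nlinarith [sq_nonneg δ]
    rw [← hT]
    nlinarith [norm_nonneg (x + δ • T x + δ • a)]
  have hvol := h.2.2 _ ⟨g.symm, rfl⟩ hsub
  have hv2 := vol_affine (Matrix.toEuclideanLin (1 + δ • A)) (δ • a) (g.symm '' closedBall 0 1)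
  have : (fun x => Matrix.toEuclideanLin (1 + δ • A) x + δ • a) '' (g.symm '' closedBall 0 1)
      = closedBall 0 1 := by
    rw [image_image]
    have : ∀ x, Matrix.toEuclideanLin (1 + δ • A) (g.symm x) + δ • a = x := by
      intro x
      rw [← affMk_apply _ hdet, ← hg]; simp
    simp only [this, image_id']
  rw [this] at hv2
  refine ball_vol_contra hd (V := volume (closedBall (0 : EuclideanSpace ℝ (Fin n)) 1)) ?_
    (measure_closedBall_pos volume _ zero_lt_one).ne' measure_closedBall_lt_top.ne
  conv_rhs => rw [hv2]
  gcongr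

theorem bipolar_mem {K : Set (EuclideanSpace ℝ (Fin n))} (hKc : IsClosed K) (hKv : Convex ℝ K)
    (h0 : (0 : EuclideanSpace ℝ (Fin n)) ∈ K) {x : EuclideanSpace ℝ (Fin n)}
    (hx : ∀ y ∈ polarSet K, ⟪x, y⟫ ≤ 1) : x ∈ K := by
  by_contra hmem
  obtain ⟨f, r, hf1, hf2⟩ := geometric_hahn_banach_closed_point hKv hKc hmem
  have hr : 0 < r := by simpa using hf1 0 h0
  set a := (InnerProductSpace.toDual ℝ (EuclideanSpace ℝ (Fin n))).symm f
  have ha : ∀ y, ⟪a, y⟫ = f y := fun y => by simp [a]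
  have := hx (r⁻¹ • a) (fun y hy => by
    rw [real_inner_smul_left, ha, inv_mul_le_iff₀ hr]; linarith [hf1 y hy])
  rw [real_inner_smul_right, real_inner_comm, ha, inv_mul_le_iff₀ hr] at this
  linarith

theorem bipolar {K : Set (EuclideanSpace ℝ (Fin n))} (hKc : IsClosed K) (hKv : Convex ℝ K)
    (h0 : (0 : EuclideanSpace ℝ (Fin n)) ∈ K) : polarSet (polarSet K) = K := by
  refine subset_antisymm (fun x hx => bipolar_mem hKc hKv h0 hx) fun x hx y hy => ?_
  rw [real_inner_comm]; exact hy x hx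

theorem polarSet_closed (K : Set (EuclideanSpace ℝ (Fin n))) : IsClosed (polarSet K) := by
  have : polarSet K = ⋂ y ∈ K, {x | ⟪x, y⟫ ≤ 1} := by ext; simp [polarSet]
  rw [this]
  exact isClosed_biInter fun y _ => isClosed_le (by fun_prop) (by fun_prop)

theorem polarSet_convex (K : Set (EuclideanSpace ℝ (Fin n))) : Convex ℝ (polarSet K) := by
  intro x hx y hy s t hs ht hst z hz
  rw [inner_add_left, real_inner_smul_left, real_inner_smul_left]
  nlinarith [hx z hz, hy z hz]

theorem polarSet_sub_ball {K : Set (EuclideanSpace ℝ (Fin n))} {r : ℝ} (hr : 0 < r)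
    (h : closedBall 0 r ⊆ K) : polarSet K ⊆ closedBall 0 r⁻¹ := by
  intro x hx
  rw [mem_closedBall_zero_iff]
  by_cases hx0 : x = 0
  · subst hx0; simp; positivity
  have hnx : 0 < ‖x‖ := norm_pos_iff.2 hx0
  have h1 := hx ((r / ‖x‖) • x) (h (by
    rw [mem_closedBall_zero_iff, norm_smul, Real.norm_of_nonneg (by positivity)]
    field_simp; rfl))
  rw [real_inner_smul_right, real_inner_self_eq_norm_sq] at h1
  rw [← one_div, le_div_iff₀ hr]
  field_simp at h1
  linarith

theorem polarSet_compact {K : Set (EuclideanSpace ℝ (Fin n))} (h : K ∈ nhds 0) :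
    IsCompact (polarSet K) := by
  obtain ⟨r, hr, hs⟩ := Metric.nhds_basis_closedBall.mem_iff.1 h
  exact (isCompact_closedBall 0 r⁻¹).of_isClosed_subset (polarSet_closed K) (polarSet_sub_ball hr hs)

theorem polarSet_nhds {K : Set (EuclideanSpace ℝ (Fin n))} (h : IsCompact K) :
    polarSet K ∈ nhds 0 := by
  obtain ⟨R, hR0, hR⟩ := h.isBounded.subset_closedBall_lt 0 0
  refine Metric.nhds_basis_closedBall.mem_iff.2 ⟨R⁻¹, by positivity, fun x hx y hy => ?_⟩
  have h1 : ‖x‖ ≤ R⁻¹ := by simpa using hx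
  have h2 : ‖y‖ ≤ R := by simpa using hR hy
  calc ⟪x, y⟫ ≤ ‖x‖ * ‖y‖ := real_inner_le_norm x y
    _ ≤ R⁻¹ * R := by gcongr
    _ = 1 := by field_simp

theorem john_contact (hn : 1 ≤ n) {K : Set (EuclideanSpace ℝ (Fin n))} (hK : IsCompact K)
    (hKv : Convex ℝ K)
    (h : IsJohnEllipsoid (closedBall (0 : EuclideanSpace ℝ (Fin n)) 1) K) :
    ∃ (ι : Type) (_ : Fintype ι) (u : ι → EuclideanSpace ℝ (Fin n)) (c : ι → ℝ),
      ContactDec u c ∧ range u ⊆ polarSet K := by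
  have h0 : K ∈ nhds 0 := Filter.mem_of_superset (closedBall_mem_nhds 0 zero_lt_one) h.2.1
  have hP := polarSet_compact h0
  rcases john_alt hn hP with h1 | ⟨A, a, htr, hneg⟩
  · exact h1
  exfalso
  set T := Matrix.toEuclideanLin A with hT
  have hTc : Continuous T := T.continuous_of_finiteDimensional
  obtain ⟨C, hC⟩ := hP.exists_bound_of_continuousOn (f := fun x => ‖T x‖ ^ 2) (by fun_prop)
  have hPb : polarSet K ⊆ closedBall 0 1 := by simpa using polarSet_sub_ball one_pos h.2.1
  have htr' : 0 < A.conjTranspose.trace := by rw [Matrix.trace_conjTranspose]; simpa using htr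
  obtain ⟨δ, hp, hd, hδ⟩ := ((perturb hP hPb (fun y => ⟪T y, y⟫ + ⟪a, y⟫) (by fun_prop) hneg C).and
    ((det_gt A.conjTranspose htr').and self_mem_nhdsWithin)).exists
  have hδ : 0 < δ := hδ
  have hdet : LinearMap.det (Matrix.toEuclideanLin (1 + δ • A.conjTranspose)) ≠ 0 := by linarith
  set g := affMk _ hdet (δ • a) with hg
  have hsub : g '' closedBall 0 1 ⊆ K := by
    rintro _ ⟨x, hx, rfl⟩
    have hx : ‖x‖ ≤ 1 := by simpa using hx
    refine bipolar_mem hK.isClosed hKv (mem_of_mem_nhds h0) fun y hy => ?_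
    rw [hg, affMk_apply, lin_apply, Matrix.toEuclideanLin_conjTranspose_eq_adjoint, ← hT,
      inner_add_left, inner_add_left, real_inner_smul_left, real_inner_smul_left,
      LinearMap.adjoint_inner_left]
    have h2 := hp y hy
    have h3 := (abs_le.1 (hC y hy)).2
    have e : ‖y + δ • T y‖ ^ 2 = ‖y‖ ^ 2 + 2 * δ * ⟪T y, y⟫ + δ ^ 2 * ‖T y‖ ^ 2 := by
      rw [norm_add_sq_real, norm_smul, mul_pow, Real.norm_eq_abs, sq_abs,
        real_inner_smul_right, real_inner_comm]
      ring
    have h4 : ⟪x, y⟫ + δ * ⟪x, T y⟫ ≤ ‖y + δ • T y‖ := by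
      rw [← real_inner_smul_right, ← inner_add_right]
      refine (real_inner_le_norm _ _).trans ?_
      exact mul_le_of_le_one_left (norm_nonneg _) hx
    nlinarith [sq_nonneg (‖y + δ • T y‖ - 1), sq_nonneg δ]
  have hvol := h.2.2 _ ⟨g, rfl⟩ hsub
  have hv2 := vol_affine (Matrix.toEuclideanLin (1 + δ • A.conjTranspose)) (δ • a) (closedBall 0 1)
  refine ball_vol_contra hd (V := volume (closedBall (0 : EuclideanSpace ℝ (Fin n)) 1)) ?_
    (measure_closedBall_pos volume _ zero_lt_one).ne' measure_closedBall_lt_top.ne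
  rw [← hv2]
  refine le_trans (le_of_eq ?_) hvol
  congr 1
  refine image_congr fun x _ => ?_
  rw [hg, affMk_apply]

end john

end piece10

section piece11

theorem sphere_hemi_finite {m : ℕ} (v : EuclideanSpace ℝ (Fin (m+1))) (hv : ‖v‖ = 1) :
    μH[(m : ℝ)] {x : EuclideanSpace ℝ (Fin (m+1)) | ‖x‖ = 1 ∧ ⟪v, x⟫ ≤ 0} < ⊤ := by
  have hfr : Module.finrank ℝ (ℝ ∙ v)ᗮ = m := by
    have : Fact (Module.finrank ℝ (EuclideanSpace ℝ (Fin (m+1))) = m + 1) := ⟨by simp⟩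
    exact Submodule.finrank_orthogonal_span_singleton (by rintro rfl; simp at hv)
  let f : (ℝ ∙ v)ᗮ → EuclideanSpace ℝ (Fin (m+1)) := fun w => stereoInvFunAux v w
  have hf : ContDiff ℝ 1 f := contDiff_stereoInvFunAux.comp (ℝ ∙ v)ᗮ.subtypeL.contDiff
  obtain ⟨C, hC⟩ := hf.contDiffOn.exists_lipschitzOnWith one_ne_zero
    (convex_closedBall (0 : (ℝ ∙ v)ᗮ) 2) (isCompact_closedBall _ _)
  have h1 := hC.hausdorffMeasure_image_le (d := m) (by positivity)
  refine lt_of_le_of_lt (measure_mono ?_) (lt_of_le_of_lt h1 ?_)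
  · rintro x ⟨hx, hvx⟩
    have hxv : x ≠ v := by
      rintro rfl
      rw [real_inner_self_eq_norm_sq, hx] at hvx; norm_num at hvx
    refine ⟨stereoToFun v x, ?_, ?_⟩
    · rw [mem_closedBall_zero_iff, stereoToFun_apply, norm_smul]
      have a : ‖(2 : ℝ) / (1 - innerSL ℝ v x)‖ ≤ 2 := by
        simp only [innerSL_apply_apply]
        rw [Real.norm_of_nonneg (by apply div_nonneg <;> linarith), div_le_iff₀ (by linarith)]
        linarith
      have b : ‖(ℝ ∙ v)ᗮ.orthogonalProjectionOnto x‖ ≤ 1 := hx ▸ Submodule.norm_orthogonalProjectionOnto_apply_le _ _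
      nlinarith [norm_nonneg ((ℝ ∙ v)ᗮ.orthogonalProjectionOnto x)]
    · have := stereo_left_inv hv (x := ⟨x, by simpa using hx⟩) hxv
      exact congrArg Subtype.val this
  · apply ENNReal.mul_lt_top (by simp)
    have h2 : IsCompact (closedBall (0 : (ℝ ∙ v)ᗮ) 2) := isCompact_closedBall _ _
    have := h2.measure_lt_top (μ := μH[(Module.finrank ℝ (ℝ ∙ v)ᗮ : ℕ)])
    rwa [hfr] at this

theorem sphere_H_finite (m : ℕ) :
    μH[(m : ℝ)] (sphere (0 : EuclideanSpace ℝ (Fin (m+1))) 1) < ⊤ := by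
  obtain ⟨v, hv⟩ := exists_norm_eq (EuclideanSpace ℝ (Fin (m+1))) zero_le_one
  refine lt_of_le_of_lt (measure_mono ?_) (lt_of_le_of_lt (measure_union_le _ _)
    (ENNReal.add_lt_top.2 ⟨sphere_hemi_finite v hv, sphere_hemi_finite (-v) (by simpa using hv)⟩))
  intro x hx
  have hx : ‖x‖ = 1 := by simpa using hx
  rcases le_total ⟪v, x⟫ 0 with h | h
  · exact Or.inl ⟨hx, h⟩
  · exact Or.inr ⟨hx, by simpa using h⟩

theorem sphere_H_pos (m : ℕ) :
    0 < μH[(m : ℝ)] (sphere (0 : EuclideanSpace ℝ (Fin (m+1))) 1) := by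
  obtain ⟨v, hv⟩ := exists_norm_eq (EuclideanSpace ℝ (Fin (m+1))) zero_le_one
  have hfr : Module.finrank ℝ (ℝ ∙ v)ᗮ = m := by
    have : Fact (Module.finrank ℝ (EuclideanSpace ℝ (Fin (m+1))) = m + 1) := ⟨by simp⟩
    exact Submodule.finrank_orthogonal_span_singleton (by rintro rfl; simp at hv)
  have hL : LipschitzWith 1 (fun x => (ℝ ∙ v)ᗮ.orthogonalProjectionOnto x) := by
    apply LipschitzWith.mk_one
    intro x y
    rw [dist_eq_norm, dist_eq_norm, ← map_sub]
    exact Submodule.norm_orthogonalProjectionOnto_apply_le _ _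
  have h1 := hL.hausdorffMeasure_image_le (d := m) (by positivity) (sphere (0 : EuclideanSpace ℝ (Fin (m+1))) 1)
  simp only [ENNReal.coe_one, ENNReal.one_rpow, one_mul] at h1
  refine lt_of_lt_of_le ?_ h1
  have h2 := (isOpen_ball (x := (0 : (ℝ ∙ v)ᗮ)) (ε := 1)).measure_pos
    μH[(Module.finrank ℝ (ℝ ∙ v)ᗮ : ℕ)] ⟨0, by simp⟩
  rw [hfr] at h2
  refine lt_of_lt_of_le h2 (measure_mono ?_)
  intro y hy
  have hy : ‖y‖ < 1 := by simpa using hy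
  have hyv : ⟪(y : EuclideanSpace ℝ (Fin (m+1))), v⟫ = 0 := by
    have := Submodule.mem_orthogonal_singleton_iff_inner_left.1 y.2
    exact this
  refine ⟨y + √(1 - ‖y‖^2) • v, ?_, ?_⟩
  · rw [mem_sphere_zero_iff_norm, ← sq_eq_sq₀ (norm_nonneg _) zero_le_one, norm_add_sq_real, inner_smul_right, hyv,
      norm_smul, hv, mul_one, Real.norm_eq_abs, sq_abs, Real.sq_sqrt (by nlinarith [norm_nonneg y])]
    simp
  · simp only [map_add, map_smul]
    rw [Submodule.orthogonalProjectionOnto_mem_subspace_eq_self,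
      Submodule.orthogonalProjectionOnto_orthogonalComplement_singleton_eq_zero]
    simp

/-- surface measure on the unit sphere -/
def surf (n : ℕ) : Measure (EuclideanSpace ℝ (Fin n)) := (μH[(n : ℝ) - 1]).restrict (sphere 0 1)

theorem surf_univ (m : ℕ) : surf (m+1) univ = μH[(m : ℝ)] (sphere (0 : EuclideanSpace ℝ (Fin (m+1))) 1) := by
  simp [surf]

theorem surf_fin {n : ℕ} (hn : 1 ≤ n) : IsFiniteMeasure (surf n) := by
  obtain ⟨m, rfl⟩ := Nat.exists_eq_add_of_le' hn
  exact ⟨by rw [surf_univ]; exact sphere_H_finite m⟩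

theorem surf_pos {n : ℕ} (hn : 1 ≤ n) : 0 < surf n univ := by
  obtain ⟨m, rfl⟩ := Nat.exists_eq_add_of_le' hn
  rw [surf_univ]; exact sphere_H_pos m

theorem surf_inv {n : ℕ} (g : EuclideanSpace ℝ (Fin n) ≃ₗᵢ[ℝ] EuclideanSpace ℝ (Fin n)) :
    (surf n).map g = surf n := by
  have h := (g.toIsometryEquiv.measurePreserving_hausdorffMeasure ((n:ℝ)-1)).restrict_preimage
    (s := sphere 0 1) isClosed_sphere.measurableSet
  have h2 : g.toIsometryEquiv ⁻¹' (sphere 0 1) = sphere 0 1 := by ext; simp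
  rw [h2] at h
  exact h.map_eq

end piece11

theorem charFun_inv {n : ℕ} {μ : Measure (EuclideanSpace ℝ (Fin n))}
    (hμ : ∀ g : EuclideanSpace ℝ (Fin n) ≃ₗᵢ[ℝ] EuclideanSpace ℝ (Fin n), μ.map g = μ)
    {s t : EuclideanSpace ℝ (Fin n)} (h : ‖s‖ = ‖t‖) : charFun μ s = charFun μ t := by
  set g : EuclideanSpace ℝ (Fin n) ≃ₗᵢ[ℝ] EuclideanSpace ℝ (Fin n) := (ℝ ∙ (s - t))ᗮ.reflection
  have hg : g s = t := Submodule.reflection_sub h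
  rw [charFun_apply, charFun_apply, ← hg]
  conv_rhs => rw [← hμ g]
  rw [integral_map g.continuous.aemeasurable (by fun_prop)]
  simp

theorem charFun_sphere {n : ℕ} {μ ν : Measure (EuclideanSpace ℝ (Fin n))}
    (hμ : ∀ g : EuclideanSpace ℝ (Fin n) ≃ₗᵢ[ℝ] EuclideanSpace ℝ (Fin n), μ.map g = μ)
    (hs : ∀ᵐ x ∂ν, ‖x‖ = 1) (t : EuclideanSpace ℝ (Fin n)) :
    ∫ x, ∫ y, Complex.exp ((⟪y, ‖t‖ • x⟫ : ℝ) * Complex.I) ∂μ ∂ν = (ν.real univ : ℂ) * charFun μ t := by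
  have : ∀ᵐ x ∂ν, ∫ y, Complex.exp ((⟪y, ‖t‖ • x⟫ : ℝ) * Complex.I) ∂μ = charFun μ t := by
    filter_upwards [hs] with x hx
    rw [← charFun_apply]
    exact charFun_inv hμ (by rw [norm_smul, hx]; simp)
  rw [integral_congr_ae this]
  simp

theorem measure_unique {n : ℕ} {μ ν : Measure (EuclideanSpace ℝ (Fin n))}
    [IsFiniteMeasure μ] [IsFiniteMeasure ν]
    (hμ : ∀ g : EuclideanSpace ℝ (Fin n) ≃ₗᵢ[ℝ] EuclideanSpace ℝ (Fin n), μ.map g = μ)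
    (hν : ∀ g : EuclideanSpace ℝ (Fin n) ≃ₗᵢ[ℝ] EuclideanSpace ℝ (Fin n), ν.map g = ν)
    (hsμ : ∀ᵐ x ∂μ, ‖x‖ = 1) (hsν : ∀ᵐ x ∂ν, ‖x‖ = 1) :
    (ν univ) • μ = (μ univ) • ν := by
  have : IsFiniteMeasure ((ν univ) • μ) := Measure.smul_finite _ (measure_ne_top _ _)
  have : IsFiniteMeasure ((μ univ) • ν) := Measure.smul_finite _ (measure_ne_top _ _)
  apply Measure.ext_of_charFun
  ext t
  rw [charFun_apply, charFun_apply, integral_smul_measure, integral_smul_measure, ← charFun_apply,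
    ← charFun_apply]
  have h1 := charFun_sphere hμ hsν t
  have h2 := charFun_sphere hν hsμ t
  have h3 : ∫ x, ∫ y, Complex.exp ((⟪y, ‖t‖ • x⟫ : ℝ) * Complex.I) ∂μ ∂ν =
      ∫ x, ∫ y, Complex.exp ((⟪y, ‖t‖ • x⟫ : ℝ) * Complex.I) ∂ν ∂μ := by
    rw [integral_integral_swap]
    · simp only [inner_smul_right, real_inner_comm]
    · apply Integrable.of_bound (C := 1)
      · apply Continuous.aestronglyMeasurable
        unfold Function.uncurry
        fun_prop
      · filter_upwards with p
        simp [Function.uncurry, Complex.norm_exp_ofReal_mul_I]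
  rw [h1, h2] at h3
  simpa [Measure.real] using h3

theorem withDensity_inv {n : ℕ} {m : Measure (EuclideanSpace ℝ (Fin n))} {ρ : EuclideanSpace ℝ (Fin n) → ℝ≥0∞}
    (hρ : Measurable ρ)
    (g : EuclideanSpace ℝ (Fin n) ≃ₗᵢ[ℝ] EuclideanSpace ℝ (Fin n)) (hm : m.map g = m)
    (hg : ∀ x, ρ (g x) = ρ x) : (m.withDensity ρ).map g = m.withDensity ρ := by
  ext s hs
  have hgm : Measurable g := g.continuous.measurable
  rw [Measure.map_apply hgm hs, withDensity_apply _ (hgm hs), withDensity_apply _ hs]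
  have h := MeasurePreserving.setLIntegral_comp_preimage ⟨hgm, hm⟩ hs hρ
  rw [← h]
  simp [hg]

/-- radial projection of the weighted Gaussian -/
def radG (n : ℕ) : Measure (EuclideanSpace ℝ (Fin n)) :=
  ((gaussianM n).withDensity (fun x => (‖x‖₊ : ℝ≥0∞))).map (fun x => ‖x‖⁻¹ • x)

theorem normalize_meas (n : ℕ) : Measurable (fun x : EuclideanSpace ℝ (Fin n) => ‖x‖⁻¹ • x) := by
  fun_prop

theorem radG_univ (n : ℕ) : radG n univ = ∫⁻ x, (‖x‖₊ : ℝ≥0∞) ∂(gaussianM n) := by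
  rw [radG, Measure.map_apply (normalize_meas n) MeasurableSet.univ]
  simp

instance radG_fin (n : ℕ) : IsFiniteMeasure (radG n) :=
  ⟨by rw [radG_univ]; exact (norm_int_gaussian n).norm.hasFiniteIntegral.trans_le' (by simp [enorm_eq_nnnorm])⟩

theorem radG_pos {n : ℕ} (hn : 1 ≤ n) : 0 < radG n univ := by
  rw [radG_univ, pos_iff_ne_zero]
  intro h
  rw [lintegral_eq_zero_iff (by fun_prop)] at h
  have h2 := (gaussianM_abs n).ae_eq h
  have : Nonempty (Fin n) := ⟨⟨0, hn⟩⟩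
  have h3 : volume ({0}ᶜ : Set (EuclideanSpace ℝ (Fin n))) = 0 := by
    refine measure_mono_null ?_ (ae_iff.1 h2)
    intro x hx
    simpa using hx
  have : ({0}ᶜ : Set (EuclideanSpace ℝ (Fin n))).Nonempty := by
    obtain ⟨v, hv⟩ := exists_norm_eq (EuclideanSpace ℝ (Fin n)) zero_le_one
    exact ⟨v, by rintro rfl; simp at hv⟩
  exact (isOpen_compl_singleton.measure_pos volume this).ne' h3

theorem radG_inv {n : ℕ} (g : EuclideanSpace ℝ (Fin n) ≃ₗᵢ[ℝ] EuclideanSpace ℝ (Fin n)) :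
    (radG n).map g = radG n := by
  have hgm : Measurable g := g.continuous.measurable
  have h1 : (gaussianM n).map g = gaussianM n :=
    withDensity_inv (by fun_prop) g g.measurePreserving.map_eq (by simp)
  have h2 := withDensity_inv (ρ := fun x => (‖x‖₊ : ℝ≥0∞)) (by fun_prop) g h1 (by simp)
  rw [radG, Measure.map_map hgm (normalize_meas n)]
  conv_rhs => rw [← h2, Measure.map_map (normalize_meas n) hgm]
  congr 1
  ext x
  simp

theorem radG_sphere (n : ℕ) : ∀ᵐ x ∂(radG n), ‖x‖ = 1 := by
  rw [radG, ae_map_iff (normalize_meas n).aemeasurable (measurableSet_eq_fun (by fun_prop) (by fun_prop)),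
    ae_withDensity_iff (by fun_prop)]
  filter_upwards with x hx
  have : ‖x‖ ≠ 0 := by simpa using hx
  simp [norm_smul, this]

theorem radG_int {n : ℕ} {L : Set (EuclideanSpace ℝ (Fin n))} (hc : Convex ℝ L) (h0 : L ∈ nhds 0) :
    ∫ x, gauge L x ∂(radG n) = ellNorm n L := by
  have hcont : Continuous (gauge L) := continuous_gauge hc h0
  rw [radG, integral_map (normalize_meas n).aemeasurable hcont.aestronglyMeasurable,
    integral_withDensity_eq_integral_smul (f := fun x => ‖x‖₊) (by fun_prop), ellNorm]
  refine integral_congr_ae (.of_forall fun x => ?_)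
  simp only
  rw [gauge_smul_of_nonneg (by positivity), NNReal.smul_def]
  by_cases hx : x = 0
  · simp [hx]
  · have : ‖x‖ ≠ 0 := by simpa using hx
    simp [this]

theorem surf_sphere (n : ℕ) : ∀ᵐ x ∂(surf n), ‖x‖ = 1 := by
  rw [surf]
  filter_upwards [ae_restrict_mem isClosed_sphere.measurableSet] with x hx
  simpa using hx

theorem surf_int {n : ℕ} (hn : 1 ≤ n) {L : Set (EuclideanSpace ℝ (Fin n))} (hc : Convex ℝ L) (h0 : L ∈ nhds 0) :
    ∫ x, gauge L x ∂(surf n) = (surf n univ).toReal / (radG n univ).toReal * ellNorm n L := by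
  have := surf_fin hn
  have h := measure_unique surf_inv radG_inv (surf_sphere n) (radG_sphere n)
  have h2 := congrArg (fun m => ∫ x, gauge L x ∂m) h
  simp only [integral_smul_measure, radG_int hc h0, smul_eq_mul] at h2
  have : (radG n univ).toReal ≠ 0 := (ENNReal.toReal_pos (radG_pos hn).ne' (measure_ne_top _ _)).ne'
  field_simp
  linarith

theorem suppFn_eq {n : ℕ} {K : Set (EuclideanSpace ℝ (Fin n))} (hK : IsCompact K) (h0 : 0 ∈ K)
    (x : EuclideanSpace ℝ (Fin n)) : suppFn K x = gauge (polarSet K) x := by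
  have hne : ((fun y => ⟪x, y⟫) '' K).Nonempty := ⟨_, 0, h0, rfl⟩
  have hb : BddAbove ((fun y => ⟪x, y⟫) '' K) := (hK.image (by fun_prop)).bddAbove
  apply le_antisymm
  · apply csSup_le hne
    rintro _ ⟨y, hy, rfl⟩
    simp only
    rw [real_inner_comm]
    apply inner_le_gauge (polarSet_nhds hK)
    intro z hz
    rw [real_inner_comm]
    exact hz y hy
  · apply le_of_forall_gt_imp_ge_of_dense
    intro t ht
    have hs0 : 0 ≤ suppFn K x := le_csSup hb ⟨0, h0, by simp⟩
    have ht0 : 0 < t := lt_of_le_of_lt hs0 ht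
    refine gauge_le_of_mem ht0.le ?_
    rw [mem_smul_set_iff_inv_smul_mem₀ ht0.ne']
    intro y hy
    rw [real_inner_smul_left, inv_mul_le_iff₀ ht0, mul_one]
    exact (le_csSup hb ⟨y, hy, rfl⟩).trans ht.le

theorem meanWidth_eq {n : ℕ} (hn : 1 ≤ n) : ∃ C : ℝ, 0 < C ∧ ∀ K : Set (EuclideanSpace ℝ (Fin n)),
    IsCompact K → Convex ℝ K → K ∈ nhds 0 → meanWidth n K = C * ellNorm n (polarSet K) := by
  have := surf_fin hn
  have hr : 0 < (radG n univ).toReal := ENNReal.toReal_pos (radG_pos hn).ne' (measure_ne_top _ _)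
  have hs : 0 < (surf n univ).toReal := ENNReal.toReal_pos (surf_pos hn).ne' (measure_ne_top _ _)
  have hb : 0 < (volume (closedBall (0 : EuclideanSpace ℝ (Fin n)) 1)).toReal :=
    ENNReal.toReal_pos (measure_closedBall_pos _ _ one_pos).ne' measure_closedBall_lt_top.ne
  have hn0 : (0:ℝ) < n := by exact_mod_cast hn
  refine ⟨(1 / (n * (volume (closedBall (0 : EuclideanSpace ℝ (Fin n)) 1)).toReal)) *
    (2 * ((surf n univ).toReal / (radG n univ).toReal)), by positivity, fun K hK hKc hK0 => ?_⟩
  have hP0 := polarSet_nhds hK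
  have hPc := polarSet_convex K
  have hcont : Continuous (gauge (polarSet K)) := continuous_gauge hPc hP0
  have hIntg : Integrable (gauge (polarSet K)) (surf n) := by
    obtain ⟨C, hC0, hC⟩ := gauge_le_mul_norm hP0
    apply Integrable.of_bound (C := C) hcont.aestronglyMeasurable
    filter_upwards [surf_sphere n] with x hx
    rw [Real.norm_of_nonneg (gauge_nonneg _)]
    simpa [hx] using hC x
  have hneg : ∫ x, gauge (polarSet K) (-x) ∂(surf n) = ∫ x, gauge (polarSet K) x ∂(surf n) := by
    conv_rhs => rw [← surf_inv (LinearIsometryEquiv.neg ℝ)]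
    rw [integral_map (by fun_prop) hcont.aestronglyMeasurable]
    simp
  have hintn : Integrable (fun x => gauge (polarSet K) (-x)) (surf n) := by
    have h2 := hIntg
    rw [← surf_inv (LinearIsometryEquiv.neg ℝ), integrable_map_measure hcont.aestronglyMeasurable (by fun_prop)] at h2
    exact h2
  simp only [meanWidth, suppFn_eq hK (mem_of_mem_nhds hK0)]
  change _ * ∫ u, _ ∂(surf n) = _
  rw [integral_add hIntg hintn, hneg, surf_int hn hPc hP0]
  ring

theorem barthe_upper_bounds
    (n : ℕ) (hn : 1 ≤ n) (K : Set (EuclideanSpace ℝ (Fin n)))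
    (hKcomp : IsCompact K) (hKconv : Convex ℝ K) (hKint : (interior K).Nonempty)
    (w : Fin (n + 1) → EuclideanSpace ℝ (Fin n)) (hw : IsRegVerts w) :
    (IsLoewnerEllipsoid (closedBall (0 : EuclideanSpace ℝ (Fin n)) 1) K →
      ellNorm n K ≤ ellNorm n (convexHull ℝ (Set.range w)) ∧
      (ellNorm n K = ellNorm n (convexHull ℝ (Set.range w)) ↔
        ∃ v : Fin (n + 1) → EuclideanSpace ℝ (Fin n),
          IsRegVerts v ∧ K = convexHull ℝ (Set.range v))) ∧
    (IsJohnEllipsoid (closedBall (0 : EuclideanSpace ℝ (Fin n)) 1) K →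
      meanWidth n K ≤ meanWidth n (polarSet (convexHull ℝ (Set.range w))) ∧
      (meanWidth n K = meanWidth n (polarSet (convexHull ℝ (Set.range w))) ↔
        ∃ v : Fin (n + 1) → EuclideanSpace ℝ (Fin n),
          IsRegVerts v ∧ K = polarSet (convexHull ℝ (Set.range v)))) := by
  constructor
  · intro h
    obtain ⟨ι, _, u, c, hd, hu⟩ := loewner_contact hn hKcomp h
    exact core_le hn hd hw hKcomp.isClosed hKconv hu
  · intro h
    have hK0 : K ∈ nhds 0 := Filter.mem_of_superset (closedBall_mem_nhds _ one_pos) h.2.1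
    obtain ⟨ι, _, u, c, hd, hu⟩ := john_contact hn hKcomp hKconv h
    have hcore := core_le hn hd hw (polarSet_closed K) (polarSet_convex K) hu
    obtain ⟨C, hC, hW⟩ := meanWidth_eq hn
    have hbip : ∀ v : Fin (n + 1) → EuclideanSpace ℝ (Fin n), IsRegVerts v →
        polarSet (polarSet (convexHull ℝ (range v))) = convexHull ℝ (range v) := fun v hv =>
      bipolar (compact_convexHull (finite_range v).isCompact).isClosed (convex_convexHull _ _)
        (mem_of_mem_nhds ((hv.dec hn).nhds hn))
    have hwn := (hw.dec hn).nhds hn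
    rw [hW K hKcomp hKconv hK0, hW _ (polarSet_compact hwn) (polarSet_convex _)
      (polarSet_nhds (compact_convexHull (finite_range w).isCompact)), hbip w hw]
    refine ⟨mul_le_mul_of_nonneg_left hcore.1 hC.le, ?_⟩
    rw [mul_right_inj' hC.ne', hcore.2]
    have hKK := bipolar hKcomp.isClosed hKconv (mem_of_mem_nhds hK0)
    constructor
    · rintro ⟨v, hv, hKv⟩
      exact ⟨v, hv, by rw [← hKv, hKK]⟩
    · rintro ⟨v, hv, hKv⟩
      exact ⟨v, hv, by rw [hKv, hbip v hv]⟩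


end
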